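/- arXiv:1610.09208 — 4 statements merged into one kernel-verified Lean document; each statement's English description precedes it below -/
import Mathlib

section
/- Let F be a binary quartic form with complex coefficients and non-zero discriminant. Then Aut*_ℂ F contains an element of order 3 if and only if I(F) = 0, and Aut*_ℂ F contains an element of order 4 if and only if J(F) = 0. -/
open Matrix

/-- The substitution action of a `2 × 2` matrix on a function of two variables:
`(F_T)(x,y) = F(t₁x + t₂y, t₃x + t₄y)`. -/
def actM (F : ℂ → ℂ → ℂ) (T : Matrix (Fin 2) (Fin 2) ℂ) : ℂ → ℂ → ℂ :=
  fun x y => F (T 0 0 * x + T 0 1 * y) (T 1 0 * x + T 1 1 * y)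

lemma actM_one (F : ℂ → ℂ → ℂ) : actM F 1 = F := by
  funext x y
  simp [actM, Matrix.one_apply]

lemma actM_mul (F : ℂ → ℂ → ℂ) (A B : Matrix (Fin 2) (Fin 2) ℂ) :
    actM F (A * B) = actM (actM F A) B := by
  funext x y
  show F _ _ = F _ _
  congr 1 <;> (simp [Matrix.mul_apply, Fin.sum_univ_two]; ring)

/-- The subgroup of `GL₂(ℂ)` consisting of matrices fixing `F` up to a non-zero scalar. -/
def projStab (F : ℂ → ℂ → ℂ) : Subgroup (GL (Fin 2) ℂ) where
  carrier := {T | ∃ l : ℂ, l ≠ 0 ∧ actM F (T : Matrix (Fin 2) (Fin 2) ℂ)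
    = fun x y => l * F x y}
  one_mem' := ⟨1, one_ne_zero, by
    simp only [Units.val_one, actM_one]
    funext x y
    rw [one_mul]⟩
  mul_mem' := by
    rintro A B ⟨l, hl, hA⟩ ⟨m, hm, hB⟩
    refine ⟨l * m, mul_ne_zero hl hm, ?_⟩
    have h1 : actM F ((A * B : GL (Fin 2) ℂ) : Matrix (Fin 2) (Fin 2) ℂ)
        = actM (actM F (A : Matrix (Fin 2) (Fin 2) ℂ)) (B : Matrix (Fin 2) (Fin 2) ℂ) := by
      rw [Units.val_mul, actM_mul]
    rw [h1, hA]
    funext x y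
    show l * F _ _ = l * m * F x y
    have h2 := congrFun (congrFun hB x) y
    unfold actM at h2
    rw [h2]
    ring
  inv_mem' := by
    rintro A ⟨l, hl, hA⟩
    refine ⟨l⁻¹, inv_ne_zero hl, ?_⟩
    funext x y
    have h1 : actM (actM F (A : Matrix (Fin 2) (Fin 2) ℂ))
        ((A⁻¹ : GL (Fin 2) ℂ) : Matrix (Fin 2) (Fin 2) ℂ) = F := by
      rw [← actM_mul, ← Units.val_mul, mul_inv_cancel, Units.val_one, actM_one]
    have h2 := congrFun (congrFun h1 x) y
    rw [hA] at h2
    unfold actM at h2 ⊢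
    field_simp at h2 ⊢
    linear_combination h2

/-- The projective general linear group `PGL₂(ℂ)`, as the quotient of `GL₂(ℂ)` by its
center (the scalar matrices). -/
abbrev PGL2 : Type := GL (Fin 2) ℂ ⧸ Subgroup.center (GL (Fin 2) ℂ)

/-- The `PGL₂(ℂ)`-automorphism group `Aut*_ℂ F`: the subgroup of `PGL₂(ℂ)` consisting of
the classes of matrices `T ∈ GL₂(ℂ)` with `F_T = λF` for some `λ ∈ ℂˣ`. -/
def AutStar (F : ℂ → ℂ → ℂ) : Subgroup PGL2 :=
  (projStab F).map (QuotientGroup.mk' (Subgroup.center (GL (Fin 2) ℂ)))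


/-- The binary quartic form `F(x,y) = a₄x⁴ + a₃x³y + a₂x²y² + a₁xy³ + a₀y⁴`. -/
noncomputable def quarticForm (a₄ a₃ a₂ a₁ a₀ : ℂ) : ℂ → ℂ → ℂ := fun x y =>
  a₄ * x ^ 4 + a₃ * x ^ 3 * y + a₂ * x ^ 2 * y ^ 2 + a₁ * x * y ^ 3 + a₀ * y ^ 4

/-- The invariant `I(F)` of a binary quartic form. -/
noncomputable def quarticI (a₄ a₃ a₂ a₁ a₀ : ℂ) : ℂ :=
  12 * a₄ * a₀ - 3 * a₃ * a₁ + a₂ ^ 2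

/-- The invariant `J(F)` of a binary quartic form. -/
noncomputable def quarticJ (a₄ a₃ a₂ a₁ a₀ : ℂ) : ℂ :=
  72 * a₄ * a₂ * a₀ + 9 * a₃ * a₂ * a₁ - 27 * a₄ * a₁ ^ 2 - 27 * a₀ * a₃ ^ 2 - 2 * a₂ ^ 3

/-- The discriminant of a binary quartic form: `Δ(F) = (4I(F)³ - J(F)²)/27`. -/
noncomputable def quarticDisc (a₄ a₃ a₂ a₁ a₀ : ℂ) : ℂ :=
  (4 * quarticI a₄ a₃ a₂ a₁ a₀ ^ 3 - quarticJ a₄ a₃ a₂ a₁ a₀ ^ 2) / 27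

/-- Forms equal as functions have equal coefficients. -/
lemma quarticForm_injective {a₄ a₃ a₂ a₁ a₀ b₄ b₃ b₂ b₁ b₀ : ℂ}
    (h : quarticForm a₄ a₃ a₂ a₁ a₀ = quarticForm b₄ b₃ b₂ b₁ b₀) :
    a₄ = b₄ ∧ a₃ = b₃ ∧ a₂ = b₂ ∧ a₁ = b₁ ∧ a₀ = b₀ := by
  have h0 := congrFun (congrFun h 1) 0
  have h1 := congrFun (congrFun h 0) 1
  have h2 := congrFun (congrFun h 1) 1
  have h3 := congrFun (congrFun h 1) (-1)
  have h4 := congrFun (congrFun h 2) 1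
  simp only [quarticForm] at h0 h1 h2 h3 h4
  ring_nf at h0 h1 h2 h3 h4
  refine ⟨h0, ?_, ?_, ?_, h1⟩
  · linear_combination -2 * h0 + h1 / 2 - h2 / 2 - h3 / 6 + h4 / 6
  · linear_combination -h0 - h1 + h2 / 2 + h3 / 2
  · linear_combination 2 * h0 - h1 / 2 + h2 - h3 / 3 - h4 / 6

/-- The substitution action preserves quartic forms, and `I`, `J` are relative invariants. -/
lemma exists_actM_quarticForm (a₄ a₃ a₂ a₁ a₀ : ℂ) (S : Matrix (Fin 2) (Fin 2) ℂ) :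
    ∃ b₄ b₃ b₂ b₁ b₀, actM (quarticForm a₄ a₃ a₂ a₁ a₀) S = quarticForm b₄ b₃ b₂ b₁ b₀ ∧
      quarticI b₄ b₃ b₂ b₁ b₀ = S.det ^ 4 * quarticI a₄ a₃ a₂ a₁ a₀ ∧
      quarticJ b₄ b₃ b₂ b₁ b₀ = S.det ^ 6 * quarticJ a₄ a₃ a₂ a₁ a₀ := by
  rw [Matrix.det_fin_two]
  unfold actM quarticForm
  generalize S 0 0 = p
  generalize S 0 1 = q
  generalize S 1 0 = r
  generalize S 1 1 = s
  refine ⟨a₄ * p ^ 4 + a₃ * p ^ 3 * r + a₂ * p ^ 2 * r ^ 2 + a₁ * p * r ^ 3 + a₀ * r ^ 4,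
    4 * a₄ * p ^ 3 * q + a₃ * (3 * p ^ 2 * q * r + p ^ 3 * s)
      + a₂ * (2 * p * q * r ^ 2 + 2 * p ^ 2 * r * s)
      + a₁ * (q * r ^ 3 + 3 * p * r ^ 2 * s) + 4 * a₀ * r ^ 3 * s,
    6 * a₄ * p ^ 2 * q ^ 2 + a₃ * (3 * p * q ^ 2 * r + 3 * p ^ 2 * q * s)
      + a₂ * (q ^ 2 * r ^ 2 + 4 * p * q * r * s + p ^ 2 * s ^ 2)
      + a₁ * (3 * q * r ^ 2 * s + 3 * p * r * s ^ 2) + 6 * a₀ * r ^ 2 * s ^ 2,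
    4 * a₄ * q ^ 3 * p + a₃ * (3 * q ^ 2 * p * s + q ^ 3 * r)
      + a₂ * (2 * q * p * s ^ 2 + 2 * q ^ 2 * s * r)
      + a₁ * (p * s ^ 3 + 3 * q * s ^ 2 * r) + 4 * a₀ * s ^ 3 * r,
    a₄ * q ^ 4 + a₃ * q ^ 3 * s + a₂ * q ^ 2 * s ^ 2 + a₁ * q * s ^ 3 + a₀ * s ^ 4,
    ?_, ?_, ?_⟩
  · funext x y
    ring
  · unfold quarticI
    ring
  · unfold quarticJ
    ring

/-- The vanishing of `I`, of `J` and of the discriminant is invariant under `GL₂(ℂ)`. -/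
lemma exists_actM_quarticForm_GL (a₄ a₃ a₂ a₁ a₀ : ℂ) (S : GL (Fin 2) ℂ) :
    ∃ b₄ b₃ b₂ b₁ b₀, actM (quarticForm a₄ a₃ a₂ a₁ a₀) S = quarticForm b₄ b₃ b₂ b₁ b₀ ∧
      (quarticI b₄ b₃ b₂ b₁ b₀ = 0 ↔ quarticI a₄ a₃ a₂ a₁ a₀ = 0) ∧
      (quarticJ b₄ b₃ b₂ b₁ b₀ = 0 ↔ quarticJ a₄ a₃ a₂ a₁ a₀ = 0) ∧
      (quarticDisc b₄ b₃ b₂ b₁ b₀ = 0 ↔ quarticDisc a₄ a₃ a₂ a₁ a₀ = 0) := by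
  obtain ⟨b₄, b₃, b₂, b₁, b₀, h, hI, hJ⟩ := exists_actM_quarticForm a₄ a₃ a₂ a₁ a₀ S
  have hS : (S : Matrix (Fin 2) (Fin 2) ℂ).det ≠ 0 := S.det_ne_zero
  have hD : quarticDisc b₄ b₃ b₂ b₁ b₀
      = (S : Matrix (Fin 2) (Fin 2) ℂ).det ^ 12 * quarticDisc a₄ a₃ a₂ a₁ a₀ := by
    unfold quarticDisc
    rw [hI, hJ]
    ring
  refine ⟨b₄, b₃, b₂, b₁, b₀, h, ?_, ?_, ?_⟩
  · simp [hI, hS]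
  · simp [hJ, hS]
  · simp [hD, hS]

/-- A power of the class of `T` in `PGL₂(ℂ)` is trivial iff the power of `T` is scalar. -/
lemma PGL2_mk_pow_eq_one_iff (T : GL (Fin 2) ℂ) (k : ℕ) :
    (QuotientGroup.mk T : PGL2) ^ k = 1 ↔
      ((T : Matrix (Fin 2) (Fin 2) ℂ) ^ k) 0 1 = 0 ∧
      ((T : Matrix (Fin 2) (Fin 2) ℂ) ^ k) 1 0 = 0 ∧
      ((T : Matrix (Fin 2) (Fin 2) ℂ) ^ k) 0 0 = ((T : Matrix (Fin 2) (Fin 2) ℂ) ^ k) 1 1 := by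
  rw [← QuotientGroup.mk_pow, QuotientGroup.eq_one_iff,
    Matrix.GeneralLinearGroup.mem_center_iff_val_mem_range_scalar, Units.val_pow_eq_pow_val]
  generalize (T : Matrix (Fin 2) (Fin 2) ℂ) ^ k = M
  constructor
  · rintro ⟨a, rfl⟩
    simp
  · rintro ⟨h1, h2, h3⟩
    refine ⟨M 0 0, ?_⟩
    ext i j
    fin_cases i <;> fin_cases j <;> simp [h1, h2, h3]

/-- Elements of given order in `AutStar F` are represented by elements of `projStab F`. -/
lemma exists_mem_autStar_iff (F : ℂ → ℂ → ℂ) (n : ℕ) :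
    (∃ g ∈ AutStar F, orderOf g = n) ↔
      ∃ T ∈ projStab F, orderOf (QuotientGroup.mk T : PGL2) = n := by
  simp [AutStar, Subgroup.mem_map]

/-- Conjugation by `S` carries `projStab F` into `projStab (actM F S)`. -/
lemma conj_mem_projStab {F : ℂ → ℂ → ℂ} {T : GL (Fin 2) ℂ} (hT : T ∈ projStab F)
    (S : GL (Fin 2) ℂ) :
    S⁻¹ * T * S ∈ projStab (actM F (S : Matrix (Fin 2) (Fin 2) ℂ)) := by
  obtain ⟨l, hl, h⟩ := hT
  refine ⟨l, hl, ?_⟩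
  rw [← actM_mul, ← Units.val_mul, mul_assoc, mul_inv_cancel_left, Units.val_mul, actM_mul, h]
  rfl

lemma orderOf_PGL2_mk_conj (T S : GL (Fin 2) ℂ) :
    orderOf (QuotientGroup.mk (S⁻¹ * T * S) : PGL2) = orderOf (QuotientGroup.mk T : PGL2) := by
  have := (MulAut.conj (QuotientGroup.mk S⁻¹ : PGL2)).orderOf_eq (QuotientGroup.mk T)
  simpa using this

lemma exists_mem_projStab_of_actM {F G : ℂ → ℂ → ℂ} {S T : GL (Fin 2) ℂ} {n : ℕ}
    (hS : actM F (S : Matrix (Fin 2) (Fin 2) ℂ) = G) (hT : T ∈ projStab G)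
    (ho : orderOf (QuotientGroup.mk T : PGL2) = n) :
    ∃ U ∈ projStab F, orderOf (QuotientGroup.mk U : PGL2) = n := by
  have hF : actM G ((S⁻¹ : GL (Fin 2) ℂ) : Matrix (Fin 2) (Fin 2) ℂ) = F := by
    rw [← hS, ← actM_mul, ← Units.val_mul, mul_inv_cancel, Units.val_one, actM_one]
  exact ⟨_, hF ▸ conj_mem_projStab hT S⁻¹, (orderOf_PGL2_mk_conj T S⁻¹).trans ho⟩

/-- A class of finite order in `PGL₂(ℂ)` is diagonalizable. -/
lemma exists_conj_diagonal (T : GL (Fin 2) ℂ) {n : ℕ} (hn : n ≠ 0)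
    (hT : (QuotientGroup.mk T : PGL2) ^ n = 1) :
    ∃ S : GL (Fin 2) ℂ, (S⁻¹ * T * S) 0 1 = 0 ∧ (S⁻¹ * T * S) 1 0 = 0 := by
  suffices h : ∃ S : Matrix (Fin 2) (Fin 2) ℂ, S.det ≠ 0 ∧
      ∃ d : Fin 2 → ℂ, (T : Matrix (Fin 2) (Fin 2) ℂ) * S = S * diagonal d by
    obtain ⟨S, hS, d, hd⟩ := h
    let S' : GL (Fin 2) ℂ := GeneralLinearGroup.mkOfDetNeZero S hS
    have key : ((S'⁻¹ * T * S' : GL (Fin 2) ℂ) : Matrix (Fin 2) (Fin 2) ℂ) = diagonal d := by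
      rw [mul_assoc, Units.val_mul, Units.inv_mul_eq_iff_eq_mul]
      exact hd
    exact ⟨S', by rw [key]; simp, by rw [key]; simp⟩
  have hdet : (T : Matrix (Fin 2) (Fin 2) ℂ).det ≠ 0 := T.det_ne_zero
  obtain ⟨h01, h10, -⟩ := (PGL2_mk_pow_eq_one_iff T n).1 hT
  generalize (T : Matrix (Fin 2) (Fin 2) ℂ) = M at *
  rw [Matrix.det_fin_two] at hdet
  obtain ⟨w, hw⟩ := IsAlgClosed.exists_pow_nat_eq
    ((M 0 0 + M 1 1) ^ 2 - 4 * (M 0 0 * M 1 1 - M 0 1 * M 1 0)) two_pos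
  obtain ⟨μ, hμ⟩ : ∃ μ, μ = (M 0 0 + M 1 1 + w) / 2 := ⟨_, rfl⟩
  obtain ⟨ν, hν⟩ : ∃ ν, ν = (M 0 0 + M 1 1 - w) / 2 := ⟨_, rfl⟩
  have htr : μ + ν = M 0 0 + M 1 1 := by rw [hμ, hν]; ring
  have hprod : μ * ν = M 0 0 * M 1 1 - M 0 1 * M 1 0 := by
    rw [hμ, hν]; linear_combination -hw / 4
  clear hμ hν hw
  have of_diag (h : M 0 1 = 0) (h' : M 1 0 = 0) : ∃ S : Matrix (Fin 2) (Fin 2) ℂ, S.det ≠ 0 ∧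
      ∃ d : Fin 2 → ℂ, M * S = S * diagonal d := by
    refine ⟨1, by simp, ![M 0 0, M 1 1], ?_⟩
    ext i j
    fin_cases i <;> fin_cases j <;> simp [h, h']
  by_cases hne : μ = ν
  · subst hne
    have hμ : μ ≠ 0 := by
      rintro rfl
      exact hdet (by linear_combination -hprod)
    have hpow (k : ℕ) : M ^ (k + 1) = ((k + 1) * μ ^ k) • M - (k * μ ^ (k + 1)) • 1 := by
      induction k with
      | zero => simp
      | succ k ih =>
        have hsq : M * M = (2 * μ) • M - (μ ^ 2) • 1 := by
          ext i j
          fin_cases i <;> fin_cases j <;>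
            simp only [Fin.zero_eta, Fin.mk_one, Matrix.mul_apply, Fin.sum_univ_two,
              Matrix.sub_apply, Matrix.smul_apply, Matrix.one_apply, smul_eq_mul] <;> simp
          · linear_combination -M 0 0 * htr + hprod
          · linear_combination -M 0 1 * htr
          · linear_combination -M 1 0 * htr
          · linear_combination -M 1 1 * htr + hprod
        rw [pow_succ, ih, sub_mul, smul_mul_assoc, smul_mul_assoc, hsq, one_mul]
        push_cast
        module
    obtain ⟨k, rfl⟩ := Nat.exists_eq_succ_of_ne_zero hn
    have hk : (k : ℂ) + 1 ≠ 0 := by exact_mod_cast k.succ_ne_zero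
    rw [Nat.succ_eq_add_one, hpow] at h01 h10
    apply of_diag
    · simpa [hk, hμ] using h01
    · simpa [hk, hμ] using h10
  · have hsub : μ - ν ≠ 0 := sub_ne_zero.2 hne
    by_cases hr : M 1 0 = 0
    · by_cases hq : M 0 1 = 0
      · exact of_diag hq hr
      · refine ⟨!![M 0 1, M 0 1; μ - M 0 0, ν - M 0 0], ?_, ![μ, ν], ?_⟩
        · rw [Matrix.det_fin_two_of]
          rw [show M 0 1 * (ν - M 0 0) - M 0 1 * (μ - M 0 0) = -(M 0 1 * (μ - ν)) by ring]
          exact neg_ne_zero.2 (mul_ne_zero hq hsub)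
        · ext i j
          fin_cases i <;> fin_cases j <;> simp [Matrix.mul_apply, Fin.sum_univ_two]
          · ring
          · ring
          · linear_combination -μ * htr + hprod
          · linear_combination -ν * htr + hprod
    · refine ⟨!![μ - M 1 1, ν - M 1 1; M 1 0, M 1 0], ?_, ![μ, ν], ?_⟩
      · rw [Matrix.det_fin_two_of]
        rw [show (μ - M 1 1) * M 1 0 - (ν - M 1 1) * M 1 0 = M 1 0 * (μ - ν) by ring]
        exact mul_ne_zero hr hsub
      · ext i j
        fin_cases i <;> fin_cases j <;> simp [Matrix.mul_apply, Fin.sum_univ_two]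
        · linear_combination -μ * htr + hprod
        · linear_combination -ν * htr + hprod
        · ring
        · ring

/-- A diagonal substitution fixing a form up to a scalar acts on each coefficient by that
scalar. -/
lemma coeff_eq_of_diagonal {b₄ b₃ b₂ b₁ b₀ : ℂ} {T : GL (Fin 2) ℂ}
    (hT : T ∈ projStab (quarticForm b₄ b₃ b₂ b₁ b₀)) (h01 : T 0 1 = 0) (h10 : T 1 0 = 0) :
    ∃ l : ℂ, b₄ * T 0 0 ^ 4 = l * b₄ ∧ b₃ * (T 0 0 ^ 3 * T 1 1) = l * b₃ ∧
      b₂ * (T 0 0 ^ 2 * T 1 1 ^ 2) = l * b₂ ∧ b₁ * (T 0 0 * T 1 1 ^ 3) = l * b₁ ∧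
      b₀ * T 1 1 ^ 4 = l * b₀ := by
  obtain ⟨l, -, h⟩ := hT
  refine ⟨l, quarticForm_injective ?_⟩
  funext x y
  have := congrFun (congrFun h x) y
  simp only [actM, quarticForm, h01, h10] at this ⊢
  linear_combination this

/-- The discriminant vanishes when `y²` divides the form. -/
lemma ne_zero_or_ne_zero_of_disc {b₄ b₃ b₂ b₁ b₀ : ℂ} (h : quarticDisc b₄ b₃ b₂ b₁ b₀ ≠ 0) :
    b₄ ≠ 0 ∨ b₃ ≠ 0 := by
  by_contra! hb
  obtain ⟨rfl, rfl⟩ := hb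
  apply h
  unfold quarticDisc quarticI quarticJ
  ring

lemma diagonal_pow_eq_one_iff {T : GL (Fin 2) ℂ} (h01 : T 0 1 = 0) (h10 : T 1 0 = 0) (k : ℕ) :
    (QuotientGroup.mk T : PGL2) ^ k = 1 ↔ T 0 0 ^ k = T 1 1 ^ k := by
  have hd : (T : Matrix (Fin 2) (Fin 2) ℂ) = diagonal ![T 0 0, T 1 1] := by
    ext i j
    fin_cases i <;> fin_cases j <;> simp [h01, h10]
  rw [PGL2_mk_pow_eq_one_iff, hd, Matrix.diagonal_pow]
  simp

lemma quarticI_eq_zero_of_diagonal {b₄ b₃ b₂ b₁ b₀ : ℂ} {T : GL (Fin 2) ℂ}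
    (hΔ : quarticDisc b₄ b₃ b₂ b₁ b₀ ≠ 0)
    (hT : T ∈ projStab (quarticForm b₄ b₃ b₂ b₁ b₀)) (h01 : T 0 1 = 0) (h10 : T 1 0 = 0)
    (ho : orderOf (QuotientGroup.mk T : PGL2) = 3) : quarticI b₄ b₃ b₂ b₁ b₀ = 0 := by
  have h3 := (diagonal_pow_eq_one_iff h01 h10 3).1 (ho ▸ pow_orderOf_eq_one _)
  have h1 : T 0 0 ≠ T 1 1 := fun h => pow_ne_one_of_lt_orderOf (n := 1) one_ne_zero
    (by omega) ((diagonal_pow_eq_one_iff h01 h10 1).2 (by rw [h]))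
  have hdet : (T : Matrix (Fin 2) (Fin 2) ℂ).det ≠ 0 := T.det_ne_zero
  obtain ⟨l, c4, c3, c2, c1, c0⟩ := coeff_eq_of_diagonal hT h01 h10
  rw [Matrix.det_fin_two, h01, zero_mul, sub_zero] at hdet
  have hb := ne_zero_or_ne_zero_of_disc hΔ
  clear hT ho hΔ
  generalize T 0 0 = u at *
  generalize T 1 1 = v at *
  have hne : u - v ≠ 0 := sub_ne_zero.2 h1
  obtain ⟨hu, hv⟩ := mul_ne_zero_iff.1 hdet
  have h40 : b₄ * b₀ = 0 := by
    have : (b₄ * b₀) * (v ^ 3 * (u - v)) = 0 := by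
      linear_combination b₀ * c4 - b₄ * c0 - b₄ * b₀ * u * h3
    simpa [hv, hne] using this
  have h31 : b₃ * b₁ = 0 := by
    have : (b₃ * b₁) * (v ^ 3 * (u - v)) = 0 := by
      linear_combination b₃ * c1 - b₁ * c3 + b₃ * b₁ * v * h3
    simpa [hv, hne] using this
  have h2 : b₂ = 0 := by
    rcases hb with hb | hb
    · have : (b₄ * b₂) * (u * v ^ 2 * (u - v)) = 0 := by
        linear_combination b₄ * c2 - b₂ * c4 + b₄ * b₂ * u * h3
      simpa [hu, hv, hne, hb] using this
    · have : (b₃ * b₂) * (u ^ 2 * v * (u - v)) = 0 := by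
        linear_combination b₂ * c3 - b₃ * c2
      simpa [hu, hv, hne, hb] using this
  unfold quarticI
  linear_combination 12 * h40 - 3 * h31 + b₂ * h2

lemma quarticJ_eq_zero_of_diagonal {b₄ b₃ b₂ b₁ b₀ : ℂ} {T : GL (Fin 2) ℂ}
    (hΔ : quarticDisc b₄ b₃ b₂ b₁ b₀ ≠ 0)
    (hT : T ∈ projStab (quarticForm b₄ b₃ b₂ b₁ b₀)) (h01 : T 0 1 = 0) (h10 : T 1 0 = 0)
    (ho : orderOf (QuotientGroup.mk T : PGL2) = 4) : quarticJ b₄ b₃ b₂ b₁ b₀ = 0 := by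
  have h4 := (diagonal_pow_eq_one_iff h01 h10 4).1 (ho ▸ pow_orderOf_eq_one _)
  have h2 : T 0 0 ^ 2 ≠ T 1 1 ^ 2 := fun h => pow_ne_one_of_lt_orderOf (n := 2) two_ne_zero
    (by omega) ((diagonal_pow_eq_one_iff h01 h10 2).2 h)
  have hdet : (T : Matrix (Fin 2) (Fin 2) ℂ).det ≠ 0 := T.det_ne_zero
  obtain ⟨l, c4, c3, c2, c1, c0⟩ := coeff_eq_of_diagonal hT h01 h10
  rw [Matrix.det_fin_two, h01, zero_mul, sub_zero] at hdet
  have hb := ne_zero_or_ne_zero_of_disc hΔ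
  clear hT ho hΔ
  generalize T 0 0 = u at *
  generalize T 1 1 = v at *
  have hne : u - v ≠ 0 := fun h => h2 (by rw [sub_eq_zero.1 h])
  have hne2 : u ^ 2 - v ^ 2 ≠ 0 := sub_ne_zero.2 h2
  obtain ⟨hu, hv⟩ := mul_ne_zero_iff.1 hdet
  have h41 : b₄ * b₁ = 0 := by
    have : (b₄ * b₁) * (v ^ 3 * (u - v)) = 0 := by
      linear_combination b₄ * c1 - b₁ * c4 + b₄ * b₁ * h4
    simpa [hv, hne] using this
  have h30 : b₃ * b₀ = 0 := by
    have : (b₃ * b₀) * (u ^ 3 * (u - v)) = 0 := by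
      linear_combination b₃ * c0 - b₀ * c3 + b₃ * b₀ * h4
    simpa [hu, hne] using this
  have hb2 : b₂ = 0 := by
    rcases hb with hb | hb
    · have : (b₄ * b₂) * (u ^ 2 * (u ^ 2 - v ^ 2)) = 0 := by
        linear_combination b₂ * c4 - b₄ * c2
      simpa [hu, hne2, hb] using this
    · have : (b₃ * b₂) * (u ^ 2 * v * (u - v)) = 0 := by
        linear_combination b₂ * c3 - b₃ * c2
      simpa [hu, hv, hne, hb] using this
  unfold quarticJ
  rw [hb2]
  linear_combination -27 * b₁ * h41 - 27 * b₃ * h30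

/-- A form of non-zero discriminant can be moved to one with `a₄ = a₂ = 0`. -/
lemma exists_actM_depressed {a₄ a₃ a₂ a₁ a₀ : ℂ} (hΔ : quarticDisc a₄ a₃ a₂ a₁ a₀ ≠ 0) :
    ∃ (S : GL (Fin 2) ℂ) (b₃ b₁ b₀ : ℂ),
      actM (quarticForm a₄ a₃ a₂ a₁ a₀) S = quarticForm 0 b₃ 0 b₁ b₀ ∧
      (quarticI 0 b₃ 0 b₁ b₀ = 0 ↔ quarticI a₄ a₃ a₂ a₁ a₀ = 0) ∧
      (quarticJ 0 b₃ 0 b₁ b₀ = 0 ↔ quarticJ a₄ a₃ a₂ a₁ a₀ = 0) ∧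
      quarticDisc 0 b₃ 0 b₁ b₀ ≠ 0 := by
  suffices h : ∃ (S : GL (Fin 2) ℂ) (b₃ b₁ b₀ : ℂ),
      actM (quarticForm a₄ a₃ a₂ a₁ a₀) S = quarticForm 0 b₃ 0 b₁ b₀ by
    obtain ⟨S, b₃, b₁, b₀, h⟩ := h
    obtain ⟨c₄, c₃, c₂, c₁, c₀, hc, hI, hJ, hD⟩ := exists_actM_quarticForm_GL a₄ a₃ a₂ a₁ a₀ S
    obtain ⟨rfl, rfl, rfl, rfl, rfl⟩ := quarticForm_injective (hc.symm.trans h)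
    exact ⟨S, _, _, _, h, hI, hJ, mt hD.1 hΔ⟩
  obtain ⟨S, hS⟩ : ∃ S : GL (Fin 2) ℂ, quarticForm a₄ a₃ a₂ a₁ a₀ (S 0 0) (S 1 0) = 0 := by
    by_cases h4 : a₄ = 0
    · exact ⟨1, by simp [quarticForm, h4]⟩
    · open Polynomial in
      obtain ⟨z, hz⟩ := IsAlgClosed.exists_root
        (C a₄ * X ^ 4 + C a₃ * X ^ 3 + C a₂ * X ^ 2 + C a₁ * X + C a₀ : ℂ[X]) (by
          rw [show (C a₄ * X ^ 4 + C a₃ * X ^ 3 + C a₂ * X ^ 2 + C a₁ * X + C a₀ : ℂ[X]).degree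
            = 4 by compute_degree!]
          norm_num)
      refine ⟨GeneralLinearGroup.mkOfDetNeZero !![z, 1; 1, 0] (by simp), ?_⟩
      simpa [GeneralLinearGroup.mkOfDetNeZero, quarticForm] using hz
  obtain ⟨b₄, b₃, b₂, b₁, b₀, hb, -, -, hD⟩ := exists_actM_quarticForm_GL a₄ a₃ a₂ a₁ a₀ S
  have hb4 : b₄ = 0 := by
    have := congrFun (congrFun hb 1) 0
    simp only [actM, mul_one, mul_zero, add_zero, hS] at this
    simpa [quarticForm] using this.symm
  subst hb4
  have hb3 : b₃ ≠ 0 := by simpa using ne_zero_or_ne_zero_of_disc (mt hD.1 hΔ)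
  let U : GL (Fin 2) ℂ :=
    GeneralLinearGroup.mkOfDetNeZero !![1, -b₂ / (3 * b₃); 0, 1] (by simp)
  have hU : (U : Matrix (Fin 2) (Fin 2) ℂ) = !![1, -b₂ / (3 * b₃); 0, 1] := rfl
  refine ⟨S * U, b₃, b₁ - b₂ ^ 2 / (3 * b₃),
    b₀ - b₁ * b₂ / (3 * b₃) + 2 * b₂ ^ 3 / (27 * b₃ ^ 2), ?_⟩
  rw [Units.val_mul, actM_mul, hb, hU]
  funext x y
  simp only [actM, quarticForm, Matrix.of_apply, Matrix.cons_val', Matrix.cons_val_zero,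
    Matrix.cons_val_one, Matrix.cons_val_fin_one]
  field_simp
  ring

lemma exists_orderOf_eq_three (b₃ b₀ : ℂ) :
    ∃ T ∈ projStab (quarticForm 0 b₃ 0 0 b₀), orderOf (QuotientGroup.mk T : PGL2) = 3 := by
  obtain ⟨ω, hω⟩ : ∃ ω : ℂ, IsPrimitiveRoot ω 3 := ⟨_, Complex.isPrimitiveRoot_exp 3 (by norm_num)⟩
  have h3 := hω.pow_eq_one
  have h1 := hω.ne_one (by norm_num)
  have h0 := hω.ne_zero (by norm_num)
  let T : GL (Fin 2) ℂ := GeneralLinearGroup.mkOfDetNeZero !![1, 0; 0, ω] (by simpa using h0)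
  have hT : (T : Matrix (Fin 2) (Fin 2) ℂ) = !![1, 0; 0, ω] := rfl
  refine ⟨T, ⟨ω, h0, ?_⟩, orderOf_eq_prime ?_ ?_⟩
  · funext x y
    simp [hT, actM, quarticForm]
    linear_combination b₀ * ω * y ^ 4 * h3
  · rw [diagonal_pow_eq_one_iff (by simp [hT]) (by simp [hT])]
    simp [hT, h3]
  · rw [← pow_one (QuotientGroup.mk T : PGL2), Ne,
      diagonal_pow_eq_one_iff (by simp [hT]) (by simp [hT])]
    simpa [hT] using h1.symm

lemma exists_orderOf_eq_four {b₃ b₁ : ℂ} (h₃ : b₃ ≠ 0) (h₁ : b₁ ≠ 0) :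
    ∃ T ∈ projStab (quarticForm 0 b₃ 0 b₁ 0), orderOf (QuotientGroup.mk T : PGL2) = 4 := by
  obtain ⟨r, hr⟩ := IsAlgClosed.exists_pow_nat_eq (-b₁ / b₃) two_pos
  have hb₁ : b₁ = -(b₃ * r ^ 2) := by
    rw [hr]
    field_simp
  have hr0 : r ≠ 0 := by
    rintro rfl
    exact h₁ (by simp [hb₁])
  let T : GL (Fin 2) ℂ := GeneralLinearGroup.mkOfDetNeZero !![r, r ^ 2; -1, r] (by
    rw [Matrix.det_fin_two_of, show r * r - r ^ 2 * -1 = 2 * r ^ 2 by ring]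
    simpa using hr0)
  have hT : (T : Matrix (Fin 2) (Fin 2) ℂ) = !![r, r ^ 2; -1, r] := rfl
  have hT2 : (T : Matrix (Fin 2) (Fin 2) ℂ) ^ 2 = !![0, 2 * r ^ 3; -2 * r, 0] := by
    rw [hT, pow_two, Matrix.mul_fin_two]
    congr! 2 <;> ring_nf
  have hT4 : (T : Matrix (Fin 2) (Fin 2) ℂ) ^ 4 = !![-4 * r ^ 4, 0; 0, -4 * r ^ 4] := by
    rw [show 4 = 2 * 2 from rfl, pow_mul, hT2, pow_two, Matrix.mul_fin_two]
    congr! 2 <;> ring_nf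
  refine ⟨T, ⟨-4 * r ^ 4, by simpa using hr0, ?_⟩, orderOf_eq_prime_pow (p := 2) (n := 1) ?_ ?_⟩
  · funext x y
    simp [hT, actM, quarticForm, hb₁]
    ring
  · rw [pow_one, PGL2_mk_pow_eq_one_iff, hT2]
    simp [hr0]
  · rw [show 2 ^ (1 + 1) = 4 from rfl, PGL2_mk_pow_eq_one_iff, hT4]
    simp

/-- For a binary quartic form `F` with complex coefficients and non-zero discriminant,
`Aut*_ℂ F` contains an element of order 3 iff `I(F) = 0`, and contains an element of
order 4 iff `J(F) = 0`. -/
theorem autStar_orders_iff (a₄ a₃ a₂ a₁ a₀ : ℂ) (hΔ : quarticDisc a₄ a₃ a₂ a₁ a₀ ≠ 0) :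
    ((∃ g ∈ AutStar (quarticForm a₄ a₃ a₂ a₁ a₀), orderOf g = 3) ↔
        quarticI a₄ a₃ a₂ a₁ a₀ = 0) ∧
    ((∃ g ∈ AutStar (quarticForm a₄ a₃ a₂ a₁ a₀), orderOf g = 4) ↔
        quarticJ a₄ a₃ a₂ a₁ a₀ = 0) := by
  constructor
  · rw [exists_mem_autStar_iff]
    constructor
    · rintro ⟨T, hT, ho⟩
      obtain ⟨S, h01, h10⟩ := exists_conj_diagonal T three_ne_zero (ho ▸ pow_orderOf_eq_one _)
      obtain ⟨b₄, b₃, b₂, b₁, b₀, hb, hI, -, hD⟩ := exists_actM_quarticForm_GL a₄ a₃ a₂ a₁ a₀ S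
      exact hI.1 (quarticI_eq_zero_of_diagonal (mt hD.1 hΔ) (hb ▸ conj_mem_projStab hT S) h01 h10
        ((orderOf_PGL2_mk_conj T S).trans ho))
    · intro hI
      obtain ⟨S, b₃, b₁, b₀, hS, hI', -, hD⟩ := exists_actM_depressed hΔ
      have hb₃ : b₃ ≠ 0 := by simpa using ne_zero_or_ne_zero_of_disc hD
      obtain rfl : b₁ = 0 := by simpa [quarticI, hb₃] using hI'.2 hI
      obtain ⟨T, hT, ho⟩ := exists_orderOf_eq_three b₃ b₀
      exact exists_mem_projStab_of_actM hS hT ho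
  · rw [exists_mem_autStar_iff]
    constructor
    · rintro ⟨T, hT, ho⟩
      obtain ⟨S, h01, h10⟩ := exists_conj_diagonal T four_ne_zero (ho ▸ pow_orderOf_eq_one _)
      obtain ⟨b₄, b₃, b₂, b₁, b₀, hb, -, hJ, hD⟩ := exists_actM_quarticForm_GL a₄ a₃ a₂ a₁ a₀ S
      exact hJ.1 (quarticJ_eq_zero_of_diagonal (mt hD.1 hΔ) (hb ▸ conj_mem_projStab hT S) h01 h10
        ((orderOf_PGL2_mk_conj T S).trans ho))
    · intro hJ
      obtain ⟨S, b₃, b₁, b₀, hS, -, hJ', hD⟩ := exists_actM_depressed hΔ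
      have hb₃ : b₃ ≠ 0 := by simpa using ne_zero_or_ne_zero_of_disc hD
      obtain rfl : b₀ = 0 := by simpa [quarticJ, hb₃] using hJ'.2 hJ
      have hb₁ : b₁ ≠ 0 := by
        rintro rfl
        exact hD (by simp [quarticDisc, quarticI, quarticJ])
      obtain ⟨T, hT, ho⟩ := exists_orderOf_eq_four hb₃ hb₁
      exact exists_mem_projStab_of_actM hS hT ho
end

section
/- Let F be a binary quartic form with complex coefficients and non-zero discriminant. Then Aut*_ℂ F is isomorphic to the Klein four-group C₂ × C₂ if I(F)·J(F) ≠ 0, isomorphic to the dihedral group D₄ of order 8 if and only if J(F) = 0, and isomorphic to the alternating group A₄ if and only if I(F) = 0. -/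
open Matrix

/-- A group of order `4p` with a non-normal subgroup of prime order `p` acts faithfully on the
four cosets of that subgroup. -/
lemma exists_injective_hom_perm_fin_four {G : Type*} [Group G] {p : ℕ} (hp : p.Prime)
    (hG : Nat.card G = 4 * p) (x g : G) (hx : orderOf x = p)
    (hg : g * x * g⁻¹ ∉ Subgroup.zpowers x) :
    ∃ f : G →* Equiv.Perm (Fin 4), Function.Injective f := by
  have hfin : Finite G := Nat.finite_of_card_ne_zero (by rw [hG]; have := hp.pos; omega)
  set C := Subgroup.zpowers x with hC
  have hCc : Nat.card C = p := by rw [hC, Nat.card_zpowers, hx]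
  have hquot : Nat.card (G ⧸ C) = 4 := by
    have h := C.card_eq_card_quotient_mul_card_subgroup
    rw [hG, hCc] at h
    exact (Nat.eq_of_mul_eq_mul_right hp.pos h).symm
  have hcore : C.normalCore = ⊥ := by
    have hle : Nat.card C.normalCore ∣ p := hCc ▸ Subgroup.card_dvd_of_le C.normalCore_le
    rcases (Nat.dvd_prime hp).mp hle with h | h
    · exact Subgroup.card_eq_one.mp h
    · have heq : C.normalCore = C :=
        Subgroup.eq_of_le_of_card_ge C.normalCore_le (by rw [h, hCc])
      have hn : C.Normal := heq ▸ C.normalCore_normal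
      exact absurd (hn.conj_mem x (Subgroup.mem_zpowers x) g) hg
  have hinj : Function.Injective (MulAction.toPermHom G (G ⧸ C)) := by
    rw [← MonoidHom.ker_eq_bot_iff, ← Subgroup.normalCore_eq_ker, hcore]
  exact ⟨(Finite.equivFinOfCardEq hquot).permCongrHom.toMonoidHom.comp
      (MulAction.toPermHom G (G ⧸ C)),
    (Finite.equivFinOfCardEq hquot).permCongrHom.injective.comp hinj⟩

lemma nat_card_perm_fin_four : Nat.card (Equiv.Perm (Fin 4)) = 24 := by
  rw [Nat.card_eq_fintype_card, Fintype.card_perm, Fintype.card_fin]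
  rfl

/-- A group of order `12` with a non-normal subgroup of order `3` is the alternating group. -/
lemma nonempty_mulEquiv_alternatingGroup {G : Type*} [Group G] (hG : Nat.card G = 12)
    (x g : G) (hx : orderOf x = 3) (hg : g * x * g⁻¹ ∉ Subgroup.zpowers x) :
    Nonempty (G ≃* alternatingGroup (Fin 4)) := by
  obtain ⟨f, hf⟩ := exists_injective_hom_perm_fin_four Nat.prime_three hG x g hx hg
  have hc : Nat.card f.range = 12 := by
    rw [← hG]; exact (Nat.card_congr (MonoidHom.ofInjective hf).toEquiv).symm
  have hi : f.range.index = 2 := by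
    have := f.range.index_mul_card
    rw [hc, nat_card_perm_fin_four] at this
    omega
  exact ⟨(MonoidHom.ofInjective hf).trans
    (MulEquiv.subgroupCongr (Equiv.Perm.eq_alternatingGroup_of_index_eq_two hi))⟩

/-- Any two groups of order `8` with non-normal subgroups of order `2` are isomorphic, both being
Sylow `2`-subgroups of the symmetric group on four letters. -/
lemma nonempty_mulEquiv_of_card_eight {G H : Type*} [Group G] [Group H]
    (hG : Nat.card G = 8) (x g : G) (hx : orderOf x = 2) (hg : g * x * g⁻¹ ∉ Subgroup.zpowers x)
    (hH : Nat.card H = 8) (y h : H) (hy : orderOf y = 2)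
    (hh : h * y * h⁻¹ ∉ Subgroup.zpowers y) : Nonempty (G ≃* H) := by
  obtain ⟨f, hf⟩ := exists_injective_hom_perm_fin_four Nat.prime_two hG x g hx hg
  obtain ⟨k, hk⟩ := exists_injective_hom_perm_fin_four Nat.prime_two hH y h hy hh
  have hfac : (24 : ℕ).factorization 2 = 3 := by
    rw [show (24 : ℕ) = 2 ^ 3 * 3 by norm_num, Nat.factorization_mul (by norm_num) (by norm_num),
      Nat.factorization_pow]
    simp [Nat.prime_two.factorization, Nat.prime_three.factorization]
  have hfc : Nat.card f.range = 8 := by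
    rw [← hG]; exact (Nat.card_congr (MonoidHom.ofInjective hf).toEquiv).symm
  have hkc : Nat.card k.range = 8 := by
    rw [← hH]; exact (Nat.card_congr (MonoidHom.ofInjective hk).toEquiv).symm
  let P : Sylow 2 (Equiv.Perm (Fin 4)) :=
    Sylow.ofCard f.range (by rw [hfc, nat_card_perm_fin_four, hfac]; norm_num)
  let Q : Sylow 2 (Equiv.Perm (Fin 4)) :=
    Sylow.ofCard k.range (by rw [hkc, nat_card_perm_fin_four, hfac]; norm_num)
  exact ⟨(MonoidHom.ofInjective hf).trans
    ((Sylow.equiv P Q).trans (MonoidHom.ofInjective hk).symm)⟩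

/-- A group of order `8` with a non-normal subgroup of order `2` is dihedral. -/
lemma nonempty_mulEquiv_dihedralGroup_four {G : Type*} [Group G] (hG : Nat.card G = 8)
    (x g : G) (hx : orderOf x = 2) (hg : g * x * g⁻¹ ∉ Subgroup.zpowers x) :
    Nonempty (G ≃* DihedralGroup 4) := by
  refine nonempty_mulEquiv_of_card_eight hG x g hx hg (DihedralGroup.nat_card.trans (by norm_num))
    (DihedralGroup.sr 0) (DihedralGroup.r 1) (DihedralGroup.orderOf_sr 0) ?_
  rw [mem_zpowers_iff_mem_range_orderOf, DihedralGroup.orderOf_sr]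
  decide

lemma isKleinFour_of_sq_eq_one {G : Type*} [Group G] (hG : Nat.card G = 4)
    (hsq : ∀ g : G, g ^ 2 = 1) : IsKleinFour G := by
  have : Finite G := Nat.finite_of_card_ne_zero (by rw [hG]; norm_num)
  have : Nontrivial G := Finite.one_lt_card_iff_nontrivial.mp (by rw [hG]; norm_num)
  refine ⟨hG, (Nat.prime_two.eq_one_or_self_of_dvd _
    (Monoid.exponent_dvd_of_forall_pow_eq_one hsq)).resolve_left fun h => ?_⟩
  exact not_subsingleton G (Monoid.exp_eq_one_iff.mp h)

/-- A group of order `4` in which every square is trivial is the Klein four-group. -/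
lemma nonempty_mulEquiv_klein {G : Type*} [Group G] (hG : Nat.card G = 4)
    (hsq : ∀ g : G, g ^ 2 = 1) :
    Nonempty (G ≃* (Multiplicative (ZMod 2) × Multiplicative (ZMod 2))) := by
  have := isKleinFour_of_sq_eq_one hG hsq
  have : IsKleinFour (Multiplicative (ZMod 2) × Multiplicative (ZMod 2)) :=
    isKleinFour_of_sq_eq_one (by simp) (by decide)
  exact IsKleinFour.nonempty_mulEquiv

/-- The coefficients of a quartic form after substitution, and covariance of `I` and `J`. -/
lemma actM_quarticForm (a₄ a₃ a₂ a₁ a₀ : ℂ) (T : Matrix (Fin 2) (Fin 2) ℂ) :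
    ∃ b₄ b₃ b₂ b₁ b₀ : ℂ,
      actM (quarticForm a₄ a₃ a₂ a₁ a₀) T = quarticForm b₄ b₃ b₂ b₁ b₀ ∧
      b₄ = quarticForm a₄ a₃ a₂ a₁ a₀ (T 0 0) (T 1 0) ∧
      quarticI b₄ b₃ b₂ b₁ b₀ = T.det ^ 4 * quarticI a₄ a₃ a₂ a₁ a₀ ∧
      quarticJ b₄ b₃ b₂ b₁ b₀ = T.det ^ 6 * quarticJ a₄ a₃ a₂ a₁ a₀ := by
  rw [Matrix.det_fin_two]
  unfold actM
  generalize T 0 0 = a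
  generalize T 0 1 = b
  generalize T 1 0 = c
  generalize T 1 1 = d
  refine ⟨a₄ * a ^ 4 + a₃ * a ^ 3 * c + a₂ * a ^ 2 * c ^ 2 + a₁ * a * c ^ 3 + a₀ * c ^ 4,
    4 * a₄ * a ^ 3 * b + a₃ * (3 * a ^ 2 * b * c + a ^ 3 * d)
      + a₂ * (2 * a * b * c ^ 2 + 2 * a ^ 2 * c * d)
      + a₁ * (b * c ^ 3 + 3 * a * c ^ 2 * d) + 4 * a₀ * c ^ 3 * d,
    6 * a₄ * a ^ 2 * b ^ 2 + a₃ * (3 * a * b ^ 2 * c + 3 * a ^ 2 * b * d)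
      + a₂ * (b ^ 2 * c ^ 2 + 4 * a * b * c * d + a ^ 2 * d ^ 2)
      + a₁ * (3 * b * c ^ 2 * d + 3 * a * c * d ^ 2) + 6 * a₀ * c ^ 2 * d ^ 2,
    4 * a₄ * a * b ^ 3 + a₃ * (b ^ 3 * c + 3 * a * b ^ 2 * d)
      + a₂ * (2 * b ^ 2 * c * d + 2 * a * b * d ^ 2)
      + a₁ * (3 * b * c * d ^ 2 + a * d ^ 3) + 4 * a₀ * c * d ^ 3,
    a₄ * b ^ 4 + a₃ * b ^ 3 * d + a₂ * b ^ 2 * d ^ 2 + a₁ * b * d ^ 3 + a₀ * d ^ 4,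
    ?_, ?_, ?_, ?_⟩
  · funext x y
    simp only [quarticForm]
    ring
  · simp only [quarticForm]
  · simp only [quarticI]
    ring
  · simp only [quarticJ]
    ring

/-- The element of `GL₂(ℂ)` with given entries. -/
noncomputable def glOf (a b c d : ℂ) (h : a * d - b * c ≠ 0) : GL (Fin 2) ℂ :=
  Matrix.GeneralLinearGroup.mkOfDetNeZero !![a, b; c, d] (by rwa [Matrix.det_fin_two_of])

lemma coe_glOf (a b c d : ℂ) (h : a * d - b * c ≠ 0) :
    (glOf a b c d h : Matrix (Fin 2) (Fin 2) ℂ) = !![a, b; c, d] := rfl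

/-- The quotient map `GL₂(ℂ) → PGL₂(ℂ)`. -/
abbrev toPGL2 : GL (Fin 2) ℂ →* PGL2 := QuotientGroup.mk' (Subgroup.center (GL (Fin 2) ℂ))

lemma toPGL2_eq_iff (A B : GL (Fin 2) ℂ) :
    toPGL2 A = toPGL2 B ↔
      ∃ s : ℂ, s ≠ 0 ∧ (B : Matrix (Fin 2) (Fin 2) ℂ) = s • (A : Matrix (Fin 2) (Fin 2) ℂ) := by
  rw [QuotientGroup.mk'_eq_mk', Matrix.GeneralLinearGroup.center_eq_range_scalar]
  constructor
  · rintro ⟨_, ⟨u, rfl⟩, rfl⟩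
    refine ⟨u, u.ne_zero, ?_⟩
    ext i j
    simp [mul_comm]
  · rintro ⟨s, hs, h⟩
    refine ⟨_, ⟨Units.mk0 s hs, rfl⟩, ?_⟩
    ext i j
    simp [h, mul_comm]

lemma mem_projStab_actM_iff (F : ℂ → ℂ → ℂ) (T g : GL (Fin 2) ℂ) :
    g ∈ projStab (actM F T) ↔ T * g * T⁻¹ ∈ projStab F := by
  have key : ∀ (F : ℂ → ℂ → ℂ) (T g : GL (Fin 2) ℂ), T * g * T⁻¹ ∈ projStab F →
      g ∈ projStab (actM F T) := by
    rintro F T g ⟨l, hl, h⟩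
    refine ⟨l, hl, ?_⟩
    rw [← actM_mul, ← Units.val_mul, show T * g = T * g * T⁻¹ * T by group, Units.val_mul,
      actM_mul, h]
    rfl
  refine ⟨fun h => ?_, key F T g⟩
  have := key (actM F T) T⁻¹ (T * g * T⁻¹) (by simpa [mul_assoc] using h)
  rwa [← actM_mul, ← Units.val_mul, mul_inv_cancel, Units.val_one, actM_one] at this

/-- Equivalent forms have isomorphic automorphism groups. -/
lemma nonempty_autStar_actM_mulEquiv (F : ℂ → ℂ → ℂ) (T : GL (Fin 2) ℂ) :
    Nonempty (AutStar F ≃* AutStar (actM F T)) := by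
  have h : AutStar F = (AutStar (actM F T)).map (MulAut.conj (toPGL2 T)).toMonoidHom := by
    ext x
    constructor
    · rintro ⟨g, hg, rfl⟩
      refine ⟨toPGL2 (T⁻¹ * g * T), ⟨_, (mem_projStab_actM_iff F T _).mpr ?_, rfl⟩, ?_⟩
      · simpa [mul_assoc] using hg
      · change toPGL2 T * toPGL2 _ * (toPGL2 T)⁻¹ = toPGL2 g
        rw [← map_inv, ← map_mul, ← map_mul]
        congr 1
        group
    · rintro ⟨_, ⟨g, hg, rfl⟩, rfl⟩
      refine ⟨T * g * T⁻¹, (mem_projStab_actM_iff F T _).mp hg, ?_⟩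
      simp
  exact ⟨(MulEquiv.subgroupCongr h).trans
    ((AutStar (actM F T)).equivMapOfInjective _ (MulAut.conj (toPGL2 T)).injective).symm⟩

/-- A quartic form with non-zero discriminant is equivalent to a Weierstrass form
`y (x³ + p x y² + q y³)`. -/
lemma exists_actM_eq_weierstrass (a₄ a₃ a₂ a₁ a₀ : ℂ) (hΔ : quarticDisc a₄ a₃ a₂ a₁ a₀ ≠ 0) :
    ∃ (T : GL (Fin 2) ℂ) (p q : ℂ),
      actM (quarticForm a₄ a₃ a₂ a₁ a₀) T = quarticForm 0 1 0 p q := by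
  obtain ⟨T, hT⟩ : ∃ T : GL (Fin 2) ℂ, quarticForm a₄ a₃ a₂ a₁ a₀
      ((T : Matrix (Fin 2) (Fin 2) ℂ) 0 0) ((T : Matrix (Fin 2) (Fin 2) ℂ) 1 0) = 0 := by
    by_cases h4 : a₄ = 0
    · exact ⟨1, by simp [quarticForm, h4]⟩
    · obtain ⟨z, hz⟩ := IsAlgClosed.exists_root
        (Polynomial.C a₄ * Polynomial.X ^ 4 + (Polynomial.C a₃ * Polynomial.X ^ 3
          + Polynomial.C a₂ * Polynomial.X ^ 2 + Polynomial.C a₁ * Polynomial.X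
          + Polynomial.C a₀)) (by
            have : Polynomial.degree (Polynomial.C a₄ * Polynomial.X ^ 4
                + (Polynomial.C a₃ * Polynomial.X ^ 3
                  + Polynomial.C a₂ * Polynomial.X ^ 2 + Polynomial.C a₁ * Polynomial.X
                  + Polynomial.C a₀)) = 4 := by
              compute_degree!
            rw [this]
            norm_num)
      refine ⟨glOf z (-1) 1 0 (by norm_num), ?_⟩
      simp [Polynomial.IsRoot] at hz
      simp only [quarticForm, coe_glOf, Matrix.of_apply, Matrix.cons_val]
      linear_combination hz
  obtain ⟨b₄, b₃, b₂, b₁, b₀, hb, hb4, hI, hJ⟩ := actM_quarticForm a₄ a₃ a₂ a₁ a₀ T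
  have hb4 : b₄ = 0 := hb4.trans hT
  subst hb4
  have hb3 : b₃ ≠ 0 := by
    rintro rfl
    refine hΔ ?_
    have hd : (T : Matrix (Fin 2) (Fin 2) ℂ).det ≠ 0 := T.det_ne_zero
    have h12 : (T : Matrix (Fin 2) (Fin 2) ℂ).det ^ 12 * quarticDisc a₄ a₃ a₂ a₁ a₀ = 0 := by
      have : (T : Matrix (Fin 2) (Fin 2) ℂ).det ^ 12 * quarticDisc a₄ a₃ a₂ a₁ a₀
          = quarticDisc 0 0 b₂ b₁ b₀ := by
        simp only [quarticDisc, hI, hJ]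
        ring
      rw [this]
      simp only [quarticDisc, quarticI, quarticJ]
      ring
    exact (mul_eq_zero.mp h12).resolve_left (pow_ne_zero _ hd)
  refine ⟨T * glOf 1 (-(b₂ / (3 * b₃ ^ 2))) 0 (1 / b₃) (by simpa using hb3),
    b₁ / b₃ ^ 3 - b₂ ^ 2 / (3 * b₃ ^ 4),
    b₀ / b₃ ^ 4 - b₂ * b₁ / (3 * b₃ ^ 5) + 2 * b₂ ^ 3 / (27 * b₃ ^ 6), ?_⟩
  rw [Units.val_mul, actM_mul, hb]
  funext x y
  simp only [actM, quarticForm, coe_glOf, Matrix.of_apply, Matrix.cons_val]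
  field_simp
  ring

/-- The scalings `x ↦ a x` preserving `y (x³ + p x y² + q y³)` up to a factor. -/
def IsScaling (p q a : ℂ) : Prop := a ≠ 0 ∧ p * (a ^ 2 - 1) = 0 ∧ q * (a ^ 3 - 1) = 0

lemma IsScaling.ne_zero {p q a : ℂ} (h : IsScaling p q a) : a ≠ 0 := h.1

/-- The substitution `x ↦ a x`. -/
noncomputable def diagGL (a : ℂ) (ha : a ≠ 0) : GL (Fin 2) ℂ := glOf a 0 0 1 (by simpa using ha)

lemma diagGL_mem_projStab {p q a : ℂ} (ha : IsScaling p q a) :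
    diagGL a ha.ne_zero ∈ projStab (quarticForm 0 1 0 p q) := by
  refine ⟨a ^ 3, pow_ne_zero _ ha.ne_zero, ?_⟩
  funext x y
  simp only [actM, quarticForm, diagGL, coe_glOf, Matrix.of_apply, Matrix.cons_val]
  linear_combination (-a * x * y ^ 3) * ha.2.1 - y ^ 4 * ha.2.2

/-- An upper triangular automorphism of a Weierstrass form is a scaling. -/
lemma of_mem_projStab_of_lower_eq_zero {p q : ℂ} {M : GL (Fin 2) ℂ}
    (hM : M ∈ projStab (quarticForm 0 1 0 p q))
    (hc : (M : Matrix (Fin 2) (Fin 2) ℂ) 1 0 = 0) :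
    ∃ (a : ℂ) (ha : IsScaling p q a), toPGL2 M = toPGL2 (diagGL a ha.ne_zero) := by
  obtain ⟨l, hl, h⟩ := hM
  have hdet : (M : Matrix (Fin 2) (Fin 2) ℂ).det ≠ 0 := M.det_ne_zero
  rw [Matrix.det_fin_two, hc, mul_zero, sub_zero] at hdet
  have hM' : (M : Matrix (Fin 2) (Fin 2) ℂ) = !![M.1 0 0, M.1 0 1; 0, M.1 1 1] := by
    conv_lhs => rw [Matrix.eta_fin_two (M : Matrix (Fin 2) (Fin 2) ℂ), hc]
  replace h := fun x y => congrFun (congrFun h x) y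
  rw [hM'] at h
  simp only [actM, Matrix.of_apply, Matrix.cons_val] at h
  generalize (M : Matrix (Fin 2) (Fin 2) ℂ) 0 0 = a at *
  generalize (M : Matrix (Fin 2) (Fin 2) ℂ) 0 1 = b at *
  generalize (M : Matrix (Fin 2) (Fin 2) ℂ) 1 1 = d at *
  have ha : a ≠ 0 := left_ne_zero_of_mul hdet
  have hd : d ≠ 0 := right_ne_zero_of_mul hdet
  have hq : quarticForm 0 (d * a ^ 3) (3 * d * a ^ 2 * b) (3 * d * a * b ^ 2 + p * a * d ^ 3)
      (d * b ^ 3 + p * b * d ^ 3 + q * d ^ 4) = quarticForm 0 l 0 (l * p) (l * q) := by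
    funext x y
    have := h x y
    simp only [quarticForm] at this ⊢
    linear_combination this
  obtain ⟨-, h3, h2, h1, h0⟩ := quarticForm_injective hq
  have hb : b = 0 := by simpa [ha, hd] using h2
  subst hb
  have h1' : p * (a ^ 2 - d ^ 2) = 0 := by
    have : (a * d) * (p * (a ^ 2 - d ^ 2)) = 0 := by linear_combination p * h3 - h1
    exact (mul_eq_zero.mp this).resolve_left hdet
  have h0' : q * (a ^ 3 - d ^ 3) = 0 := by
    have : d * (q * (a ^ 3 - d ^ 3)) = 0 := by linear_combination q * h3 - h0
    exact (mul_eq_zero.mp this).resolve_left hd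
  refine ⟨a / d, ⟨div_ne_zero ha hd, ?_, ?_⟩, ?_⟩
  · field_simp
    linear_combination h1'
  · field_simp
    linear_combination h0'
  · rw [toPGL2_eq_iff]
    refine ⟨d⁻¹, inv_ne_zero hd, ?_⟩
    rw [hM', diagGL, coe_glOf]
    ext i j
    fin_cases i <;> fin_cases j <;> simp [hd, div_eq_inv_mul]

/-- The finite roots of the Weierstrass form `y (x³ + p x y² + q y³)`. -/
abbrev CubicRoot (p q : ℂ) : Type := {e : ℂ // e ^ 3 + p * e + q = 0}

lemma cubicRoot_deriv_ne_zero {p q : ℂ} (hΔ : quarticDisc 0 1 0 p q ≠ 0) (e : CubicRoot p q) :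
    3 * (e : ℂ) ^ 2 + p ≠ 0 := by
  obtain ⟨e, he⟩ := e
  intro h
  refine hΔ ?_
  obtain rfl : p = -3 * e ^ 2 := by linear_combination h
  obtain rfl : q = 2 * e ^ 3 := by linear_combination he
  simp only [quarticDisc, quarticI, quarticJ]
  ring

/-- The involution exchanging the root at infinity with the finite root `e`. -/
noncomputable def rootInvolution {p q : ℂ} (hΔ : quarticDisc 0 1 0 p q ≠ 0)
    (e : CubicRoot p q) : GL (Fin 2) ℂ :=
  glOf e (2 * (e : ℂ) ^ 2 + p) 1 (-e) (by
    have := neg_ne_zero.mpr (cubicRoot_deriv_ne_zero hΔ e)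
    intro h
    exact this (by linear_combination h))

lemma rootInvolution_mem_projStab {p q : ℂ} (hΔ : quarticDisc 0 1 0 p q ≠ 0)
    (e : CubicRoot p q) : rootInvolution hΔ e ∈ projStab (quarticForm 0 1 0 p q) := by
  refine ⟨(3 * (e : ℂ) ^ 2 + p) ^ 2, pow_ne_zero _ (cubicRoot_deriv_ne_zero hΔ e), ?_⟩
  obtain ⟨e, he⟩ := e
  obtain rfl : q = -e ^ 3 - p * e := by linear_combination he
  funext x y
  simp only [actM, quarticForm, rootInvolution, coe_glOf, Matrix.of_apply, Matrix.cons_val]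
  ring

lemma toPGL2_rootInvolution_mul_self {p q : ℂ} (hΔ : quarticDisc 0 1 0 p q ≠ 0)
    (e : CubicRoot p q) :
    toPGL2 (rootInvolution hΔ e) * toPGL2 (rootInvolution hΔ e) = 1 := by
  rw [← map_mul, ← map_one toPGL2, eq_comm, toPGL2_eq_iff]
  refine ⟨3 * (e : ℂ) ^ 2 + p, cubicRoot_deriv_ne_zero hΔ e, ?_⟩
  rw [Units.val_mul, rootInvolution, coe_glOf]
  ext i j
  fin_cases i <;> fin_cases j <;> simp [Matrix.mul_apply, Fin.sum_univ_two] <;> ring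

/-- A representative moving the root at infinity to a given root. -/
noncomputable def rootRep {p q : ℂ} (hΔ : quarticDisc 0 1 0 p q ≠ 0) :
    Option (CubicRoot p q) → GL (Fin 2) ℂ
  | none => 1
  | some e => rootInvolution hΔ e

lemma rootRep_mem_projStab {p q : ℂ} (hΔ : quarticDisc 0 1 0 p q ≠ 0)
    (i : Option (CubicRoot p q)) : rootRep hΔ i ∈ projStab (quarticForm 0 1 0 p q) := by
  cases i with
  | none => exact one_mem _
  | some e => exact rootInvolution_mem_projStab hΔ e

lemma toPGL2_rootRep_mul_self {p q : ℂ} (hΔ : quarticDisc 0 1 0 p q ≠ 0)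
    (i : Option (CubicRoot p q)) : toPGL2 (rootRep hΔ i) * toPGL2 (rootRep hΔ i) = 1 := by
  cases i with
  | none => simp [rootRep]
  | some e => exact toPGL2_rootInvolution_mul_self hΔ e

/-- The decomposition of automorphisms of a Weierstrass form. -/
noncomputable def autStarParam {p q : ℂ} (hΔ : quarticDisc 0 1 0 p q ≠ 0)
    (x : Option (CubicRoot p q) × {a : ℂ // IsScaling p q a}) :
    AutStar (quarticForm 0 1 0 p q) :=
  ⟨toPGL2 (rootRep hΔ x.1 * diagGL x.2 x.2.2.ne_zero),
    ⟨_, mul_mem (rootRep_mem_projStab hΔ x.1) (diagGL_mem_projStab x.2.2), rfl⟩⟩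

lemma autStarParam_injective {p q : ℂ} (hΔ : quarticDisc 0 1 0 p q ≠ 0) :
    Function.Injective (autStarParam hΔ) := by
  rintro ⟨i, a, ha⟩ ⟨j, b, hb⟩ h
  obtain ⟨s, hs, h⟩ := (toPGL2_eq_iff _ _).mp (Subtype.ext_iff.mp h)
  have h00 := congrFun (congrFun h 0) 0
  have h01 := congrFun (congrFun h 0) 1
  have h10 := congrFun (congrFun h 1) 0
  have h11 := congrFun (congrFun h 1) 1
  rcases i with _ | e <;> rcases j with _ | e' <;>
    simp [rootRep, rootInvolution, diagGL, coe_glOf, Matrix.mul_apply, Fin.sum_univ_two]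
      at h00 h01 h10 h11
  · subst h11
    simpa using h00.symm
  · exact absurd h10 hb.ne_zero
  · rcases h10 with h10 | h10
    · exact absurd h10 hs
    · exact absurd h10 ha.ne_zero
  · have hee : (e' : ℂ) = e := by
      have : b * ((e' : ℂ) - e) = 0 := by linear_combination h00 - e * h10
      exact sub_eq_zero.mp ((mul_eq_zero.mp this).resolve_left hb.ne_zero)
    obtain rfl : e' = e := Subtype.ext hee
    have hs1 : s = 1 := by
      have : (3 * (e' : ℂ) ^ 2 + p) * (s - 1) = 0 := by linear_combination -(e' : ℂ) * h11 - h01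
      exact sub_eq_zero.mp
        ((mul_eq_zero.mp this).resolve_left (cubicRoot_deriv_ne_zero hΔ e'))
    subst hs1
    simpa using h10.symm

lemma autStarParam_surjective {p q : ℂ} (hΔ : quarticDisc 0 1 0 p q ≠ 0) :
    Function.Surjective (autStarParam hΔ) := by
  rintro ⟨_, M, hM, rfl⟩
  obtain ⟨i, hi⟩ : ∃ i, ((rootRep hΔ i * M : GL (Fin 2) ℂ) : Matrix (Fin 2) (Fin 2) ℂ) 1 0 = 0 := by
    by_cases hc : (M : Matrix (Fin 2) (Fin 2) ℂ) 1 0 = 0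
    · exact ⟨none, by simpa [rootRep] using hc⟩
    · obtain ⟨l, hl, h⟩ := hM
      have h0 := congrFun (congrFun h 1) 0
      simp only [actM, quarticForm] at h0
      have hroot : (M.1 0 0 / M.1 1 0) ^ 3 + p * (M.1 0 0 / M.1 1 0) + q = 0 := by
        have : M.1 1 0 * (M.1 0 0 ^ 3 + p * M.1 0 0 * M.1 1 0 ^ 2 + q * M.1 1 0 ^ 3) = 0 := by
          linear_combination h0
        have := (mul_eq_zero.mp this).resolve_left hc
        field_simp
        linear_combination this
      refine ⟨some ⟨_, hroot⟩, ?_⟩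
      simp [rootRep, rootInvolution, coe_glOf, Matrix.mul_apply, Fin.sum_univ_two]
      field_simp
      ring
  obtain ⟨a, ha, h⟩ :=
    of_mem_projStab_of_lower_eq_zero (mul_mem (rootRep_mem_projStab hΔ i) hM) hi
  refine ⟨(i, ⟨a, ha⟩), Subtype.ext ?_⟩
  change toPGL2 (rootRep hΔ i * diagGL a ha.ne_zero) = toPGL2 M
  rw [map_mul, ← h, map_mul, ← mul_assoc, toPGL2_rootRep_mul_self, one_mul]

lemma nat_card_cubicRoot {p q : ℂ} (hΔ : quarticDisc 0 1 0 p q ≠ 0) :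
    Nat.card (CubicRoot p q) = 3 := by
  have hD : -4 * p ^ 3 - 27 * q ^ 2 ≠ 0 := by
    refine fun h => hΔ ?_
    simp only [quarticDisc, quarticI, quarticJ]
    linear_combination h
  obtain ⟨e, he⟩ := IsAlgClosed.exists_root
    (Polynomial.X ^ 3 + (Polynomial.C p * Polynomial.X + Polynomial.C q)) (by
      have : Polynomial.degree (Polynomial.X ^ 3
          + (Polynomial.C p * Polynomial.X + Polynomial.C q)) = 3 := by compute_degree!
      rw [this]
      norm_num)
  simp only [Polynomial.IsRoot, Polynomial.eval_add, Polynomial.eval_pow, Polynomial.eval_X,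
    Polynomial.eval_mul, Polynomial.eval_C] at he
  obtain ⟨d, hd⟩ := IsAlgClosed.exists_pow_nat_eq (-3 * e ^ 2 - 4 * p) (n := 2) (by norm_num)
  obtain rfl : p = -(d ^ 2 + 3 * e ^ 2) / 4 := by linear_combination (1 / 4) * hd
  obtain rfl : q = -(e ^ 3 - (d ^ 2 + 3 * e ^ 2) / 4 * e) := by linear_combination he
  have hd0 : d ≠ 0 := by
    rintro rfl
    refine hD ?_
    ring
  have h1 : d ≠ 3 * e := by
    rintro rfl
    refine hD ?_
    ring
  have h2 : d ≠ -(3 * e) := by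
    rintro rfl
    refine hD ?_
    ring
  have hset : {z : ℂ | z ^ 3 + -(d ^ 2 + 3 * e ^ 2) / 4 * z
      + -(e ^ 3 - (d ^ 2 + 3 * e ^ 2) / 4 * e) = 0} = {e, (-e + d) / 2, (-e - d) / 2} := by
    ext z
    simp only [Set.mem_ofPred_eq, Set.mem_insert_iff, Set.mem_singleton_iff]
    rw [← sub_eq_zero (a := z), ← sub_eq_zero (a := z) (b := (-e + d) / 2),
      ← sub_eq_zero (a := z) (b := (-e - d) / 2), ← mul_eq_zero, ← mul_eq_zero]
    ring_nf
  change Set.ncard {z : ℂ | _} = 3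
  rw [hset, Set.ncard_eq_three]
  refine ⟨_, _, _, fun h => h1 ?_, fun h => h2 ?_, fun h => hd0 ?_, rfl⟩
  · linear_combination -2 * h
  · linear_combination 2 * h
  · linear_combination h

lemma nat_card_autStar {p q : ℂ} (hΔ : quarticDisc 0 1 0 p q ≠ 0) :
    Nat.card (AutStar (quarticForm 0 1 0 p q)) = 4 * Nat.card {a : ℂ // IsScaling p q a} := by
  have : Finite (CubicRoot p q) :=
    Nat.finite_of_card_ne_zero (by rw [nat_card_cubicRoot hΔ]; norm_num)
  rw [← Nat.card_congr (Equiv.ofBijective _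
    ⟨autStarParam_injective hΔ, autStarParam_surjective hΔ⟩), Nat.card_prod, Finite.card_option,
    nat_card_cubicRoot hΔ]

lemma toPGL2_diagGL_pow (a : ℂ) (ha : a ≠ 0) (n : ℕ) :
    toPGL2 (diagGL a ha) ^ n = toPGL2 (diagGL (a ^ n) (pow_ne_zero n ha)) := by
  induction n with
  | zero =>
    rw [pow_zero, ← map_one toPGL2]
    congr 1
    ext i j
    fin_cases i <;> fin_cases j <;> simp [diagGL, coe_glOf]
  | succ n ih =>
    rw [pow_succ, ih, ← map_mul]
    congr 1
    ext i j
    fin_cases i <;> fin_cases j <;>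
      simp [diagGL, coe_glOf, Matrix.mul_apply, Fin.sum_univ_two, pow_succ]

lemma toPGL2_diagGL_eq_one_iff (a : ℂ) (ha : a ≠ 0) : toPGL2 (diagGL a ha) = 1 ↔ a = 1 := by
  have h1 : toPGL2 (diagGL 1 one_ne_zero) = 1 := by
    simpa using (toPGL2_diagGL_pow 1 one_ne_zero 0).symm
  refine ⟨fun h => ?_, fun h => by subst h; exact h1⟩
  rw [← h1, toPGL2_eq_iff] at h
  obtain ⟨s, hs, h⟩ := h
  have h00 := congrFun (congrFun h 0) 0
  have h11 := congrFun (congrFun h 1) 1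
  simp [diagGL, coe_glOf] at h00 h11
  rw [← h11, one_mul] at h00
  exact h00.symm

/-- The involution at a nonzero root does not normalize a nontrivial group of scalings. -/
lemma rootInvolution_conj_notMem {p q : ℂ} (hΔ : quarticDisc 0 1 0 p q ≠ 0) (e : CubicRoot p q)
    (he : (e : ℂ) ≠ 0) (a : ℂ) (ha : a ≠ 0) (ha1 : a ≠ 1) (b : ℂ) (hb : b ≠ 0) :
    toPGL2 (rootInvolution hΔ e) * toPGL2 (diagGL a ha) * (toPGL2 (rootInvolution hΔ e))⁻¹ ≠
      toPGL2 (diagGL b hb) := by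
  rw [inv_eq_of_mul_eq_one_right (toPGL2_rootInvolution_mul_self hΔ e), ← map_mul, ← map_mul,
    Ne, eq_comm, toPGL2_eq_iff]
  rintro ⟨s, hs, h⟩
  have h10 := congrFun (congrFun h 1) 0
  simp [rootInvolution, diagGL, coe_glOf, Matrix.mul_apply, Fin.sum_univ_two] at h10
  have : (e : ℂ) * (a - 1) = 0 := by linear_combination h10
  exact (mul_ne_zero he (sub_ne_zero.mpr ha1)) this

lemma exists_cubicRoot_ne_zero {p q : ℂ} (hΔ : quarticDisc 0 1 0 p q ≠ 0) :
    ∃ e : CubicRoot p q, (e : ℂ) ≠ 0 := by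
  by_contra! h
  have : Subsingleton (CubicRoot p q) :=
    ⟨fun x y => Subtype.ext ((h x).trans (h y).symm)⟩
  have := Finite.card_le_one_iff_subsingleton.mpr this
  rw [nat_card_cubicRoot hΔ] at this
  omega

/-- A nontrivial scaling of prime order generates a non-normal subgroup. -/
lemma exists_not_normal {p q : ℂ} (hΔ : quarticDisc 0 1 0 p q ≠ 0) {n : ℕ} (hn : n.Prime)
    (a : ℂ) (ha : IsScaling p q a) (ha1 : a ≠ 1) (han : a ^ n = 1) :
    ∃ x g : AutStar (quarticForm 0 1 0 p q), orderOf x = n ∧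
      g * x * g⁻¹ ∉ Subgroup.zpowers x := by
  obtain ⟨e, he⟩ := exists_cubicRoot_ne_zero hΔ
  set x : AutStar (quarticForm 0 1 0 p q) :=
    ⟨toPGL2 (diagGL a ha.ne_zero), ⟨_, diagGL_mem_projStab ha, rfl⟩⟩ with hx
  have hfact : Fact n.Prime := ⟨hn⟩
  have hxo : orderOf x = n := by
    refine orderOf_eq_prime (Subtype.ext ?_) fun h => ha1 ?_
    · change toPGL2 (diagGL a ha.ne_zero) ^ n = 1
      rw [toPGL2_diagGL_pow, toPGL2_diagGL_eq_one_iff]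
      exact han
    · exact (toPGL2_diagGL_eq_one_iff a ha.ne_zero).mp (Subtype.ext_iff.mp h)
  refine ⟨x, ⟨toPGL2 (rootInvolution hΔ e), ⟨_, rootInvolution_mem_projStab hΔ e, rfl⟩⟩, hxo, ?_⟩
  have hfin : IsOfFinOrder x := orderOf_pos_iff.mp (hxo ▸ hn.pos)
  rw [← hfin.mem_powers_iff_mem_zpowers]
  rintro ⟨k, hk⟩
  refine rootInvolution_conj_notMem hΔ e he a ha.ne_zero ha1 (a ^ k) (pow_ne_zero k ha.ne_zero) ?_
  rw [← toPGL2_diagGL_pow]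
  exact (Subtype.ext_iff.mp hk).symm

lemma isScaling_iff_of_ne_zero {p q : ℂ} (hp : p ≠ 0) (hq : q ≠ 0) (a : ℂ) :
    IsScaling p q a ↔ a = 1 := by
  constructor
  · rintro ⟨-, h2, h3⟩
    have h2 := (mul_eq_zero.mp h2).resolve_left hp
    have h3 := (mul_eq_zero.mp h3).resolve_left hq
    linear_combination h3 - a * h2
  · rintro rfl
    simp [IsScaling]

/-- The classification for Weierstrass forms with `I J ≠ 0`. -/
lemma autStar_weierstrass_klein {p q : ℂ} (hΔ : quarticDisc 0 1 0 p q ≠ 0)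
    (hp : p ≠ 0) (hq : q ≠ 0) :
    Nat.card (AutStar (quarticForm 0 1 0 p q)) = 4 ∧
    Nonempty (AutStar (quarticForm 0 1 0 p q) ≃*
      (Multiplicative (ZMod 2) × Multiplicative (ZMod 2))) := by
  have hc : Nat.card (AutStar (quarticForm 0 1 0 p q)) = 4 := by
    rw [nat_card_autStar hΔ]
    simp_rw [isScaling_iff_of_ne_zero hp hq]
    simp
  refine ⟨hc, nonempty_mulEquiv_klein hc fun g => ?_⟩
  obtain ⟨⟨i, a, ha⟩, rfl⟩ := autStarParam_surjective hΔ g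
  obtain rfl := (isScaling_iff_of_ne_zero hp hq a).mp ha
  refine Subtype.ext ?_
  change toPGL2 (rootRep hΔ i * diagGL 1 ha.ne_zero) ^ 2 = 1
  rw [map_mul, (toPGL2_diagGL_eq_one_iff 1 ha.ne_zero).mpr rfl, mul_one, sq,
    toPGL2_rootRep_mul_self]

/-- The classification for Weierstrass forms with `J = 0`. -/
lemma autStar_weierstrass_dihedral {p : ℂ} (hΔ : quarticDisc 0 1 0 p 0 ≠ 0) (hp : p ≠ 0) :
    Nat.card (AutStar (quarticForm 0 1 0 p 0)) = 8 ∧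
    Nonempty (AutStar (quarticForm 0 1 0 p 0) ≃* DihedralGroup 4) := by
  have hA : {a : ℂ | IsScaling p 0 a} = {1, -1} := by
    ext a
    simp only [IsScaling, Set.mem_ofPred_eq, Set.mem_insert_iff, Set.mem_singleton_iff,
      mul_eq_zero, hp, false_or, true_or, and_true]
    rw [show a ^ 2 - 1 = (a - 1) * (a + 1) by ring, mul_eq_zero, sub_eq_zero,
      add_eq_zero_iff_eq_neg]
    constructor
    · exact fun h => h.2
    · rintro (rfl | rfl) <;> simp
  have hc : Nat.card (AutStar (quarticForm 0 1 0 p 0)) = 8 := by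
    rw [nat_card_autStar hΔ]
    change 4 * Set.ncard {a : ℂ | IsScaling p 0 a} = 8
    rw [hA, Set.ncard_pair (by norm_num)]
  have hm : IsScaling p 0 (-1) := by simp [IsScaling]
  obtain ⟨x, g, hx, hg⟩ := exists_not_normal hΔ Nat.prime_two (-1) hm (by norm_num) (by norm_num)
  exact ⟨hc, nonempty_mulEquiv_dihedralGroup_four hc x g hx hg⟩

/-- The classification for Weierstrass forms with `I = 0`. -/
lemma autStar_weierstrass_alternating {q : ℂ} (hΔ : quarticDisc 0 1 0 0 q ≠ 0) (hq : q ≠ 0) :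
    Nat.card (AutStar (quarticForm 0 1 0 0 q)) = 12 ∧
    Nonempty (AutStar (quarticForm 0 1 0 0 q) ≃* alternatingGroup (Fin 4)) := by
  have hζ := Complex.isPrimitiveRoot_exp 3 (by norm_num)
  set ζ := Complex.exp (2 * Real.pi * Complex.I / (3 : ℕ)) with hζdef
  have hA : {a : ℂ | IsScaling 0 q a} = (Polynomial.nthRootsFinset 3 (1 : ℂ) : Set ℂ) := by
    ext a
    simp only [IsScaling, Set.mem_ofPred_eq, Finset.mem_coe, mul_eq_zero, hq, false_or, true_or,
      true_and, sub_eq_zero, Polynomial.mem_nthRootsFinset (by norm_num : 0 < 3)]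
    refine ⟨fun h => h.2, fun h => ⟨?_, h⟩⟩
    rintro rfl
    norm_num at h
  have hc : Nat.card (AutStar (quarticForm 0 1 0 0 q)) = 12 := by
    rw [nat_card_autStar hΔ]
    change 4 * Set.ncard {a : ℂ | IsScaling 0 q a} = 12
    rw [hA, Set.ncard_coe_finset, hζ.card_nthRootsFinset]
  have hm : IsScaling 0 q ζ := ⟨hζ.ne_zero (by norm_num), by simp, by simp [hζ.pow_eq_one]⟩
  obtain ⟨x, g, hx, hg⟩ := exists_not_normal hΔ Nat.prime_three ζ hm
    (hζ.ne_one (by norm_num)) hζ.pow_eq_one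
  exact ⟨hc, nonempty_mulEquiv_alternatingGroup hc x g hx hg⟩

/-- For a binary quartic form `F` with complex coefficients and non-zero discriminant:
`Aut*_ℂ F` is isomorphic to the Klein four-group if `I(F)·J(F) ≠ 0`, isomorphic to the
dihedral group `D₄` of order 8 iff `J(F) = 0`, and isomorphic to the alternating group
`A₄` iff `I(F) = 0`. -/
theorem quartic_autStar_classification (a₄ a₃ a₂ a₁ a₀ : ℂ)
    (hΔ : quarticDisc a₄ a₃ a₂ a₁ a₀ ≠ 0) :
    (quarticI a₄ a₃ a₂ a₁ a₀ * quarticJ a₄ a₃ a₂ a₁ a₀ ≠ 0 →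
      Nonempty ((AutStar (quarticForm a₄ a₃ a₂ a₁ a₀)) ≃*
        (Multiplicative (ZMod 2) × Multiplicative (ZMod 2)))) ∧
    (Nonempty ((AutStar (quarticForm a₄ a₃ a₂ a₁ a₀)) ≃* DihedralGroup 4) ↔
      quarticJ a₄ a₃ a₂ a₁ a₀ = 0) ∧
    (Nonempty ((AutStar (quarticForm a₄ a₃ a₂ a₁ a₀)) ≃* alternatingGroup (Fin 4)) ↔
      quarticI a₄ a₃ a₂ a₁ a₀ = 0) := by
  obtain ⟨T, p, q, hT⟩ := exists_actM_eq_weierstrass a₄ a₃ a₂ a₁ a₀ hΔ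
  obtain ⟨b₄, b₃, b₂, b₁, b₀, hb, -, hI, hJ⟩ := actM_quarticForm a₄ a₃ a₂ a₁ a₀ T
  obtain ⟨rfl, rfl, rfl, rfl, rfl⟩ := quarticForm_injective (hT.symm.trans hb)
  have hd : (T : Matrix (Fin 2) (Fin 2) ℂ).det ≠ 0 := T.det_ne_zero
  obtain ⟨φ⟩ := nonempty_autStar_actM_mulEquiv (quarticForm a₄ a₃ a₂ a₁ a₀) T
  rw [hT] at φ
  have hI0 : quarticI a₄ a₃ a₂ a₁ a₀ = 0 ↔ p = 0 := by
    have : quarticI 0 1 0 p q = -3 * p := by simp only [quarticI]; ring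
    rw [← mul_eq_zero_iff_left (pow_ne_zero 4 hd), ← hI, this]
    simp
  have hJ0 : quarticJ a₄ a₃ a₂ a₁ a₀ = 0 ↔ q = 0 := by
    have : quarticJ 0 1 0 p q = -27 * q := by simp only [quarticJ]; ring
    rw [← mul_eq_zero_iff_left (pow_ne_zero 6 hd), ← hJ, this]
    simp
  have hΔ' : quarticDisc 0 1 0 p q ≠ 0 := by
    have : quarticDisc 0 1 0 p q
        = (T : Matrix (Fin 2) (Fin 2) ℂ).det ^ 12 * quarticDisc a₄ a₃ a₂ a₁ a₀ := by
      simp only [quarticDisc, hI, hJ]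
      ring
    rw [this]
    exact mul_ne_zero (pow_ne_zero _ hd) hΔ
  have hcard := Nat.card_congr φ.toEquiv
  have hD4 : Nonempty ((AutStar (quarticForm a₄ a₃ a₂ a₁ a₀)) ≃* DihedralGroup 4) →
      Nat.card (AutStar (quarticForm 0 1 0 p q)) = 8 := fun ⟨ψ⟩ => by
    rw [← hcard, Nat.card_congr ψ.toEquiv, DihedralGroup.nat_card]
  have hA4 : Nonempty ((AutStar (quarticForm a₄ a₃ a₂ a₁ a₀)) ≃* alternatingGroup (Fin 4)) →
      Nat.card (AutStar (quarticForm 0 1 0 p q)) = 12 := fun ⟨ψ⟩ => by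
    have := two_mul_nat_card_alternatingGroup (α := Fin 4)
    rw [nat_card_perm_fin_four] at this
    rw [← hcard, Nat.card_congr ψ.toEquiv]
    omega
  rw [mul_ne_zero_iff, Ne, Ne, hI0, hJ0]
  by_cases hp : p = 0
  · subst hp
    have hq : q ≠ 0 := by
      rintro rfl
      exact hΔ' (by simp [quarticDisc, quarticI, quarticJ])
    obtain ⟨hc, ⟨ψ⟩⟩ := autStar_weierstrass_alternating hΔ' hq
    refine ⟨fun h => absurd rfl h.1, ⟨fun h => ?_, fun h => absurd h hq⟩,
      fun _ => rfl, fun _ => ⟨φ.trans ψ⟩⟩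
    have := hD4 h
    omega
  · by_cases hq : q = 0
    · subst hq
      obtain ⟨hc, ⟨ψ⟩⟩ := autStar_weierstrass_dihedral hΔ' hp
      refine ⟨fun h => absurd rfl h.2, ⟨fun _ => rfl, fun _ => ⟨φ.trans ψ⟩⟩,
        fun h => ?_, fun h => absurd h hp⟩
      have := hA4 h
      omega
    · obtain ⟨hc, ⟨ψ⟩⟩ := autStar_weierstrass_klein hΔ' hp hq
      refine ⟨fun _ => ⟨φ.trans ψ⟩, ⟨fun h => ?_, fun h => absurd h hq⟩,
        fun h => ?_, fun h => absurd h hp⟩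
      · have := hD4 h
        omega
      · have := hA4 h
        omega
end

section
/- Let F be a binary cubic form with integer coefficients and non-zero discriminant. Then Aut F = {I} (the trivial group) if and only if F is irreducible over ℚ and Δ(F) is not the square of a rational number. -/
/-- The binary cubic form `F(x,y) = b₃x³ + b₂x²y + b₁xy² + b₀y³` over `ℚ`, with integer
coefficients. -/
def cubicFormQ (b₃ b₂ b₁ b₀ : ℤ) (x y : ℚ) : ℚ :=
  (b₃ : ℚ) * x ^ 3 + (b₂ : ℚ) * x ^ 2 * y + (b₁ : ℚ) * x * y ^ 2 + (b₀ : ℚ) * y ^ 3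

/-- The discriminant of the binary cubic form with coefficients `b₃, b₂, b₁, b₀`. -/
def cubicDisc (b₃ b₂ b₁ b₀ : ℤ) : ℤ :=
  18 * b₃ * b₂ * b₁ * b₀ - 4 * b₂ ^ 3 * b₀ + b₂ ^ 2 * b₁ ^ 2
    - 4 * b₃ * b₁ ^ 3 - 27 * b₃ ^ 2 * b₀ ^ 2

/-- The rational automorphism group of the cubic form, as a set of non-singular rational
`2 × 2` matrices fixing `F` under the substitution action. -/
def cubicAut (b₃ b₂ b₁ b₀ : ℤ) : Set (Matrix (Fin 2) (Fin 2) ℚ) :=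
  {T | T.det ≠ 0 ∧ ∀ x y : ℚ,
    cubicFormQ b₃ b₂ b₁ b₀ (T 0 0 * x + T 0 1 * y) (T 1 0 * x + T 1 1 * y)
      = cubicFormQ b₃ b₂ b₁ b₀ x y}

/-- `F` has a linear factor with rational coefficients. (`F` is irreducible over `ℚ` iff
this fails.) -/
def HasRationalLinearFactor (b₃ b₂ b₁ b₀ : ℤ) : Prop :=
  ∃ p q c₂ c₁ c₀ : ℚ, ∀ x y : ℚ,
    cubicFormQ b₃ b₂ b₁ b₀ x y = (p * x + q * y) * (c₂ * x ^ 2 + c₁ * x * y + c₀ * y ^ 2)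

/-- Two rational binary cubic forms that agree as functions have the same coefficients. -/
theorem cubic_coeff_ext {a b c d a' b' c' d' : ℚ}
    (h : ∀ x y : ℚ, a * x ^ 3 + b * x ^ 2 * y + c * x * y ^ 2 + d * y ^ 3
      = a' * x ^ 3 + b' * x ^ 2 * y + c' * x * y ^ 2 + d' * y ^ 3) :
    a = a' ∧ b = b' ∧ c = c' ∧ d = d' := by
  have h10 := h 1 0
  have h01 := h 0 1
  have h11 := h 1 1
  have h1m := h 1 (-1)
  norm_num at h10 h01 h11 h1m
  refine ⟨?_, ?_, ?_, ?_⟩ <;> linarith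

/-- The coefficient equations expressing that the substitution with matrix `[[p, q], [r, s]]`
fixes the cubic form with coefficients `a, b, c, d`. -/
def FixesCubic (a b c d p q r s : ℚ) : Prop :=
  a * p ^ 3 + b * p ^ 2 * r + c * p * r ^ 2 + d * r ^ 3 = a ∧
  3 * a * p ^ 2 * q + b * (p ^ 2 * s + 2 * p * q * r) + c * (q * r ^ 2 + 2 * p * r * s)
    + 3 * d * r ^ 2 * s = b ∧
  3 * a * p * q ^ 2 + b * (q ^ 2 * r + 2 * p * q * s) + c * (p * s ^ 2 + 2 * q * r * s)
    + 3 * d * r * s ^ 2 = c ∧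
  a * q ^ 3 + b * q ^ 2 * s + c * q * s ^ 2 + d * s ^ 3 = d

theorem fixesCubic_iff (a b c d p q r s : ℚ) :
    FixesCubic a b c d p q r s ↔ ∀ x y : ℚ,
      a * (p * x + q * y) ^ 3 + b * (p * x + q * y) ^ 2 * (r * x + s * y)
        + c * (p * x + q * y) * (r * x + s * y) ^ 2 + d * (r * x + s * y) ^ 3
      = a * x ^ 3 + b * x ^ 2 * y + c * x * y ^ 2 + d * y ^ 3 := by
  constructor
  · rintro ⟨h3, h2, h1, h0⟩ x y
    linear_combination x ^ 3 * h3 + x ^ 2 * y * h2 + x * y ^ 2 * h1 + y ^ 3 * h0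
  · intro h
    exact cubic_coeff_ext fun x y => by linear_combination h x y

theorem mem_cubicAut_iff (b₃ b₂ b₁ b₀ : ℤ) (T : Matrix (Fin 2) (Fin 2) ℚ) :
    T ∈ cubicAut b₃ b₂ b₁ b₀ ↔
      T.det ≠ 0 ∧ FixesCubic b₃ b₂ b₁ b₀ (T 0 0) (T 0 1) (T 1 0) (T 1 1) := by
  rw [fixesCubic_iff]
  rfl

/-- The discriminant of the cubic form with rational coefficients `a, b, c, d`. -/
def rationalCubicDisc (a b c d : ℚ) : ℚ :=
  18 * a * b * c * d - 4 * b ^ 3 * d + b ^ 2 * c ^ 2 - 4 * a * c ^ 3 - 27 * a ^ 2 * d ^ 2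

theorem cast_cubicDisc (b₃ b₂ b₁ b₀ : ℤ) :
    (cubicDisc b₃ b₂ b₁ b₀ : ℚ) = rationalCubicDisc b₃ b₂ b₁ b₀ := by
  simp [cubicDisc, rationalCubicDisc]

theorem rationalCubicDisc_substitution (a b c d p q r s : ℚ) :
    rationalCubicDisc (a * p ^ 3 + b * p ^ 2 * r + c * p * r ^ 2 + d * r ^ 3)
      (3 * a * p ^ 2 * q + b * (p ^ 2 * s + 2 * p * q * r) + c * (q * r ^ 2 + 2 * p * r * s)
        + 3 * d * r ^ 2 * s)
      (3 * a * p * q ^ 2 + b * (q ^ 2 * r + 2 * p * q * s) + c * (p * s ^ 2 + 2 * q * r * s)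
        + 3 * d * r * s ^ 2)
      (a * q ^ 3 + b * q ^ 2 * s + c * q * s ^ 2 + d * s ^ 3)
    = (p * s - q * r) ^ 6 * rationalCubicDisc a b c d := by
  unfold rationalCubicDisc
  ring

theorem FixesCubic.det_eq {a b c d p q r s : ℚ} (h : FixesCubic a b c d p q r s)
    (hΔ : rationalCubicDisc a b c d ≠ 0) : p * s - q * r = 1 ∨ p * s - q * r = -1 := by
  have key := rationalCubicDisc_substitution a b c d p q r s
  obtain ⟨h3, h2, h1, h0⟩ := h
  rw [h3, h2, h1, h0] at key
  have h6 : (p * s - q * r) ^ 6 = 1 := mul_right_cancel₀ hΔ (by linarith)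
  have hsq : (p * s - q * r) ^ 2 = 1 :=
    (pow_eq_one_iff_of_nonneg (sq_nonneg _) (n := 3) (by norm_num)).1 (by rw [← h6]; ring)
  exact eq_or_eq_neg_of_sq_eq_sq _ 1 (by rw [hsq, one_pow])

/-- Covariance of the Hessian of a cubic form under substitutions. -/
theorem hessian_substitution {a b c d a' b' c' d' p q r s : ℚ}
    (h3 : a' = a * p ^ 3 + b * p ^ 2 * r + c * p * r ^ 2 + d * r ^ 3)
    (h2 : b' = 3 * a * p ^ 2 * q + b * (p ^ 2 * s + 2 * p * q * r)
      + c * (q * r ^ 2 + 2 * p * r * s) + 3 * d * r ^ 2 * s)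
    (h1 : c' = 3 * a * p * q ^ 2 + b * (q ^ 2 * r + 2 * p * q * s)
      + c * (p * s ^ 2 + 2 * q * r * s) + 3 * d * r * s ^ 2)
    (h0 : d' = a * q ^ 3 + b * q ^ 2 * s + c * q * s ^ 2 + d * s ^ 3)
    {A B C : ℚ} (hA : A = b ^ 2 - 3 * a * c) (hB : B = b * c - 9 * a * d)
    (hC : C = c ^ 2 - 3 * b * d) :
    (p * s - q * r) ^ 2 * (A * p ^ 2 + B * p * r + C * r ^ 2) = b' ^ 2 - 3 * a' * c' ∧
    (p * s - q * r) ^ 2 * (2 * A * p * q + B * (p * s + q * r) + 2 * C * r * s)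
      = b' * c' - 9 * a' * d' ∧
    (p * s - q * r) ^ 2 * (A * q ^ 2 + B * q * s + C * s ^ 2) = c' ^ 2 - 3 * b' * d' := by
  subst h3 h2 h1 h0 hA hB hC
  refine ⟨?_, ?_, ?_⟩ <;> ring

/-- A substitution of determinant one fixing a cubic form fixes its Hessian covariant. -/
theorem FixesCubic.hessian {a b c d p q r s : ℚ} (h : FixesCubic a b c d p q r s)
    (hdet : p * s - q * r = 1) {A B C : ℚ} (hA : A = b ^ 2 - 3 * a * c)
    (hB : B = b * c - 9 * a * d) (hC : C = c ^ 2 - 3 * b * d) :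
    A * p ^ 2 + B * p * r + C * r ^ 2 = A ∧
    2 * A * p * q + B * (p * s + q * r) + 2 * C * r * s = B ∧
    A * q ^ 2 + B * q * s + C * s ^ 2 = C := by
  obtain ⟨h3, h2, h1, h0⟩ := h
  have key := hessian_substitution h3.symm h2.symm h1.symm h0.symm hA hB hC
  rwa [hdet, one_pow, one_mul, one_mul, one_mul, ← hA, ← hB, ← hC] at key

/-- A determinant-one substitution fixing a cubic form of non-zero non-square discriminant is
the identity. -/
theorem FixesCubic.eq_one {a b c d p q r s : ℚ} (h : FixesCubic a b c d p q r s)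
    (hdet : p * s - q * r = 1) (hΔ : rationalCubicDisc a b c d ≠ 0)
    (hsq : ¬ ∃ t : ℚ, rationalCubicDisc a b c d = t ^ 2) :
    p = 1 ∧ q = 0 ∧ r = 0 ∧ s = 1 := by
  obtain ⟨A, hA⟩ : ∃ A, A = b ^ 2 - 3 * a * c := ⟨_, rfl⟩
  obtain ⟨B, hB⟩ : ∃ B, B = b * c - 9 * a * d := ⟨_, rfl⟩
  obtain ⟨C, hC⟩ : ∃ C, C = c ^ 2 - 3 * b * d := ⟨_, rfl⟩
  obtain ⟨D, hD⟩ : ∃ D, D = rationalCubicDisc a b c d := ⟨_, rfl⟩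
  rw [← hD] at hΔ hsq
  have hH : B ^ 2 - 4 * A * C = -3 * D := by
    rw [hA, hB, hC, hD, rationalCubicDisc]
    ring
  obtain ⟨k1, k2, k3⟩ := h.hessian hdet hA hB hC
  have l1 : A * (p - s) = -B * r := by
    linear_combination s * k1 - r / 2 * k2 - (A * p + B / 2 * r) * hdet
  have l2 : A * q = -C * r := by
    linear_combination s / 2 * k2 - r * k3 - (A * q + B / 2 * s) * hdet
  have l3 : C * (s - p) = -B * q := by
    linear_combination -q / 2 * k2 + p * k3 - (B / 2 * q + C * s) * hdet
  obtain ⟨u, hu⟩ : ∃ u, u = (p + s) / 2 := ⟨_, rfl⟩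
  obtain ⟨w, hw⟩ : ∃ w, w = ((p - s) * B - 2 * A * q + 2 * C * r) / (-6 * D) := ⟨_, rfl⟩
  have hwD : w * (-6 * D) = (p - s) * B - 2 * A * q + 2 * C * r := by
    rw [hw]
    exact div_mul_cancel₀ _ (mul_ne_zero (by norm_num) hΔ)
  have hps : p - s = 2 * w * B := by
    apply mul_right_cancel₀ hΔ
    linear_combination (p - s) / 3 * hH + B / 3 * hwD + 2 / 3 * C * l1 - 2 / 3 * A * l3
  have hq : q = 2 * w * C := by
    apply mul_right_cancel₀ hΔ
    linear_combination q / 3 * hH + C / 3 * hwD - B / 3 * l3 + 2 / 3 * C * l2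
  have hr : r = -2 * w * A := by
    apply mul_right_cancel₀ hΔ
    linear_combination r / 3 * hH - A / 3 * hwD - B / 3 * l1 + 2 / 3 * A * l2
  have hp : p = u + w * B := by linarith
  have hs : s = u - w * B := by linarith
  clear hw hu hwD hps l1 l2 l3 k1 k2 k3
  subst hp hs hq hr
  have hn : u ^ 2 + 3 * D * w ^ 2 = 1 := by linear_combination hdet + w ^ 2 * hH
  obtain ⟨α, hα⟩ : ∃ α, α = u ^ 3 - 9 * u * w ^ 2 * D - 1 := ⟨_, rfl⟩
  obtain ⟨β, hβ⟩ : ∃ β, β = u ^ 2 * w - w ^ 3 * D := ⟨_, rfl⟩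
  obtain ⟨h3, h2, h1, h0⟩ := h
  have e3 : α * a + β * (3 * a * B - 2 * b * A) = 0 := by
    rw [rationalCubicDisc] at hD
    subst hα hβ hA hB hC hD
    linear_combination h3
  have e2 : α * b + β * (b * B + 6 * a * C - 4 * c * A) = 0 := by
    rw [rationalCubicDisc] at hD
    subst hα hβ hA hB hC hD
    linear_combination h2
  have e1 : α * c + β * (-c * B + 4 * b * C - 6 * d * A) = 0 := by
    rw [rationalCubicDisc] at hD
    subst hα hβ hA hB hC hD
    linear_combination h1
  have e0 : α * d + β * (2 * c * C - 3 * d * B) = 0 := by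
    rw [rationalCubicDisc] at hD
    subst hα hβ hA hB hC hD
    linear_combination h0
  have m32 : a * (b * B + 6 * a * C - 4 * c * A) - b * (3 * a * B - 2 * b * A) = 2 * A ^ 2 := by
    subst hA hB hC
    ring
  have m10 : c * (2 * c * C - 3 * d * B) - d * (-c * B + 4 * b * C - 6 * d * A) = 2 * C ^ 2 := by
    subst hA hB hC
    ring
  have m30 : 3 * (a * (2 * c * C - 3 * d * B) - d * (3 * a * B - 2 * b * A))
      + (b * (-c * B + 4 * b * C - 6 * d * A) - c * (b * B + 6 * a * C - 4 * c * A))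
      = 2 * (B ^ 2 + 2 * A * C) := by
    subst hA hB hC
    ring
  have hβ0 : β = 0 := by
    by_contra hne
    have hA0 : A = 0 := by
      have : β * A ^ 2 = 0 := by linear_combination (a * e2 - b * e3) / 2 - β / 2 * m32
      simpa [hne] using this
    have hC0 : C = 0 := by
      have : β * C ^ 2 = 0 := by linear_combination (c * e0 - d * e1) / 2 - β / 2 * m10
      simpa [hne] using this
    have hB0 : B = 0 := by
      have : β * B ^ 2 = 0 := by
        linear_combination (3 * (a * e0 - d * e3) + (b * e1 - c * e2)) / 2 - β / 2 * m30
          - 2 * β * C * hA0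
      simpa [hne] using this
    rw [hA0, hB0, hC0] at hH
    exact hΔ (by linarith)
  have hα0 : α = 0 := by
    by_contra hne
    rw [hβ0] at e3 e2 e1 e0
    simp only [zero_mul, add_zero, mul_eq_zero, hne, false_or] at e3 e2 e1 e0
    apply hΔ
    rw [hD, e3, e2, e1, e0, rationalCubicDisc]
    norm_num
  have hcubic : (u - 1) * (2 * u + 1) ^ 2 = 0 := by
    linear_combination hα0 - hα + 3 * u * hn
  rcases mul_eq_zero.1 hcubic with hu | hu
  · have hu1 : u = 1 := by linarith
    have hw0 : w = 0 := by
      subst hu1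
      have hDw : D * w ^ 2 = 0 := by linarith
      simpa [hΔ] using hDw
    subst hu1 hw0
    norm_num
  · have hu1 : u = -1 / 2 := by
      have : 2 * u + 1 = 0 := by simpa using hu
      linarith
    subst hu1
    have hw0 : w ≠ 0 := by
      rintro rfl
      norm_num at hn
    refine absurd ⟨1 / (2 * w), ?_⟩ hsq
    field_simp
    linarith

/-- A cubic form of non-zero square discriminant is fixed by a substitution of order three. -/
theorem exists_fixesCubic_of_disc_eq_sq {a b c d t : ℚ} (hΔ : rationalCubicDisc a b c d ≠ 0)
    (ht : rationalCubicDisc a b c d = t ^ 2) :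
    ∃ p q r s : ℚ, p * s - q * r = 1 ∧ p + s = -1 ∧ FixesCubic a b c d p q r s := by
  have ht0 : t ≠ 0 := by
    rintro rfl
    exact hΔ (by rw [ht]; norm_num)
  obtain ⟨w, hw⟩ : ∃ w, w = 1 / (2 * t) := ⟨_, rfl⟩
  have hw' : 4 * w ^ 2 * rationalCubicDisc a b c d = 1 := by
    rw [ht, hw]
    field_simp
    norm_num
  rw [rationalCubicDisc] at hw'
  refine ⟨-1 / 2 + w * (b * c - 9 * a * d), 2 * w * (c ^ 2 - 3 * b * d),
    -2 * w * (b ^ 2 - 3 * a * c), -1 / 2 - w * (b * c - 9 * a * d), ?_, ?_, ?_, ?_, ?_, ?_⟩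
  · linear_combination 3 / 4 * hw'
  · ring
  · linear_combination (9 / 8 * a - w / 4 *
      (3 * a * (b * c - 9 * a * d) - 2 * b * (b ^ 2 - 3 * a * c))) * hw'
  · linear_combination (9 / 8 * b - w / 4 *
      (b * (b * c - 9 * a * d) + 6 * a * (c ^ 2 - 3 * b * d) - 4 * c * (b ^ 2 - 3 * a * c))) * hw'
  · linear_combination (9 / 8 * c - w / 4 *
      (-c * (b * c - 9 * a * d) + 4 * b * (c ^ 2 - 3 * b * d) - 6 * d * (b ^ 2 - 3 * a * c))) * hw'
  · linear_combination (9 / 8 * d - w / 4 *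
      (2 * c * (c ^ 2 - 3 * b * d) - 3 * d * (b * c - 9 * a * d))) * hw'

/-- A cubic form of non-zero discriminant with a linear factor is fixed by a reflection. -/
theorem exists_fixesCubic_of_linear_factor {m n e f g : ℚ}
    (hΔ : rationalCubicDisc (m * e) (m * f + n * e) (m * g + n * f) (n * g) ≠ 0) :
    ∃ p q r s : ℚ, p * s - q * r = -1 ∧
      FixesCubic (m * e) (m * f + n * e) (m * g + n * f) (n * g) p q r s := by
  obtain ⟨k, hk⟩ : ∃ k, k = e * n ^ 2 - f * n * m + g * m ^ 2 := ⟨_, rfl⟩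
  have hk0 : k ≠ 0 := by
    intro h0
    apply hΔ
    have : rationalCubicDisc (m * e) (m * f + n * e) (m * g + n * f) (n * g)
        = (f ^ 2 - 4 * e * g) * (e * n ^ 2 - f * n * m + g * m ^ 2) ^ 2 := by
      rw [rationalCubicDisc]
      ring
    rw [this, ← hk, h0]
    ring
  obtain ⟨i, hi⟩ : ∃ i, i = k⁻¹ := ⟨_, rfl⟩
  have hik : i * (e * n ^ 2 - f * n * m + g * m ^ 2) = 1 := by
    rw [← hk, hi, inv_mul_cancel₀ hk0]
  obtain ⟨α, hα⟩ : ∃ α, α = i * (-2 * e * n + f * m) := ⟨_, rfl⟩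
  obtain ⟨β, hβ⟩ : ∃ β, β = i * (-f * n + 2 * g * m) := ⟨_, rfl⟩
  refine ⟨1 + α * n, β * n, -α * m, 1 - β * m, ?_, ?_⟩
  · rw [hα, hβ]
    linear_combination -2 * hik
  · rw [fixesCubic_iff]
    intro x y
    have hL : m * ((1 + α * n) * x + β * n * y) + n * (-α * m * x + (1 - β * m) * y)
        = m * x + n * y := by ring
    have hQ : e * ((1 + α * n) * x + β * n * y) ^ 2
        + f * ((1 + α * n) * x + β * n * y) * (-α * m * x + (1 - β * m) * y)
        + g * (-α * m * x + (1 - β * m) * y) ^ 2 = e * x ^ 2 + f * x * y + g * y ^ 2 := by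
      rw [hα, hβ]
      linear_combination (i * ((-2 * e * n + f * m) * x + (-f * n + 2 * g * m) * y) ^ 2) * hik
    have := congrArg₂ (· * ·) hL hQ
    linear_combination this

/-- A cubic form with a non-trivial rational zero has a rational linear factor. -/
theorem hasRationalLinearFactor_of_zero {b₃ b₂ b₁ b₀ : ℤ} {x y : ℚ} (hxy : x ≠ 0 ∨ y ≠ 0)
    (h : cubicFormQ b₃ b₂ b₁ b₀ x y = 0) : HasRationalLinearFactor b₃ b₂ b₁ b₀ := by
  unfold HasRationalLinearFactor
  simp only [cubicFormQ] at h ⊢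
  by_cases hy : y = 0
  · subst hy
    have hx : x ≠ 0 := by simpa using hxy
    have hb : (b₃ : ℚ) = 0 := by simpa [hx] using h
    refine ⟨0, 1, b₂, b₁, b₀, fun z w => ?_⟩
    rw [hb]
    ring
  · obtain ⟨t, rfl⟩ : ∃ t, x = t * y := ⟨x / y, by field_simp⟩
    have ht : (b₃ : ℚ) * t ^ 3 + b₂ * t ^ 2 + b₁ * t + b₀ = 0 := by
      apply mul_right_cancel₀ (pow_ne_zero 3 hy)
      linear_combination h
    refine ⟨1, -t, b₃, b₂ + b₃ * t, b₁ + b₂ * t + b₃ * t ^ 2, fun z w => ?_⟩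
    linear_combination w ^ 3 * ht

theorem mul_mem_cubicAut {b₃ b₂ b₁ b₀ : ℤ} {S T : Matrix (Fin 2) (Fin 2) ℚ}
    (hS : S ∈ cubicAut b₃ b₂ b₁ b₀) (hT : T ∈ cubicAut b₃ b₂ b₁ b₀) :
    S * T ∈ cubicAut b₃ b₂ b₁ b₀ := by
  refine ⟨by rw [Matrix.det_mul]; exact mul_ne_zero hS.1 hT.1, fun x y => ?_⟩
  rw [← hT.2 x y, ← hS.2 (T 0 0 * x + T 0 1 * y)]
  simp only [Matrix.mul_apply, Fin.sum_univ_two]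
  congr 1 <;> ring

/-- A determinant-one automorphism of a cubic form of non-zero non-square discriminant is
the identity. -/
theorem eq_one_of_mem_cubicAut {b₃ b₂ b₁ b₀ : ℤ} {T : Matrix (Fin 2) (Fin 2) ℚ}
    (hT : T ∈ cubicAut b₃ b₂ b₁ b₀) (hdet : T.det = 1)
    (hΔ : rationalCubicDisc b₃ b₂ b₁ b₀ ≠ 0)
    (hsq : ¬ ∃ t : ℚ, rationalCubicDisc b₃ b₂ b₁ b₀ = t ^ 2) : T = 1 := by
  rw [Matrix.det_fin_two] at hdet
  obtain ⟨h00, h01, h10, h11⟩ := ((mem_cubicAut_iff ..).1 hT).2.eq_one hdet hΔ hsq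
  ext i j
  fin_cases i <;> fin_cases j <;> simpa

/-- A cubic form with an involutory automorphism of determinant `-1` has a rational linear
factor. -/
theorem hasRationalLinearFactor_of_involution {b₃ b₂ b₁ b₀ : ℤ}
    {T : Matrix (Fin 2) (Fin 2) ℚ} (hT : T ∈ cubicAut b₃ b₂ b₁ b₀) (hdet : T.det = -1)
    (hTT : T * T = 1) : HasRationalLinearFactor b₃ b₂ b₁ b₀ := by
  have hsq : ∀ i j, T i 0 * T 0 j + T i 1 * T 1 j = (1 : Matrix (Fin 2) (Fin 2) ℚ) i j := by
    intro i j
    rw [← hTT, Matrix.mul_apply, Fin.sum_univ_two]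
  have hneg : ∀ x y, T 0 0 * x + T 0 1 * y = -x → T 1 0 * x + T 1 1 * y = -y →
      cubicFormQ b₃ b₂ b₁ b₀ x y = 0 := by
    intro x y hx hy
    have := hT.2 x y
    rw [hx, hy] at this
    simp only [cubicFormQ] at this ⊢
    linarith
  have h00 := hsq 0 0
  have h01 := hsq 0 1
  have h10 := hsq 1 0
  have h11 := hsq 1 1
  simp at h00 h01 h10 h11
  by_cases hcol : T 0 0 - 1 ≠ 0 ∨ T 1 0 ≠ 0
  · exact hasRationalLinearFactor_of_zero hcol
      (hneg _ _ (by linear_combination h00) (by linear_combination h10))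
  · push Not at hcol
    rw [Matrix.det_fin_two, hcol.2] at hdet
    have hone : T 1 1 = -1 := by linear_combination hdet - T 1 1 * hcol.1
    exact hasRationalLinearFactor_of_zero (x := T 0 1) (y := T 1 1 - 1)
      (Or.inr (by rw [hone]; norm_num))
      (hneg _ _ (by linear_combination h01) (by linear_combination h11))

/-- For a binary cubic form with integer coefficients and non-zero discriminant, the rational
automorphism group is trivial iff `F` is irreducible over `ℚ` and `Δ(F)` is not the square
of a rational number. -/
theorem cubic_aut_trivial_iff (b₃ b₂ b₁ b₀ : ℤ) (hΔ : cubicDisc b₃ b₂ b₁ b₀ ≠ 0) :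
    cubicAut b₃ b₂ b₁ b₀ = {1} ↔
      ¬ HasRationalLinearFactor b₃ b₂ b₁ b₀ ∧
        ¬ ∃ r : ℚ, (cubicDisc b₃ b₂ b₁ b₀ : ℚ) = r ^ 2 := by
  have hΔ' : rationalCubicDisc b₃ b₂ b₁ b₀ ≠ 0 := by
    rw [← cast_cubicDisc]
    exact_mod_cast hΔ
  rw [cast_cubicDisc]
  constructor
  · intro haut
    have htriv : ∀ p q r s : ℚ, p * s - q * r ≠ 0 → FixesCubic b₃ b₂ b₁ b₀ p q r s →
        p = 1 ∧ q = 0 ∧ r = 0 ∧ s = 1 := by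
      intro p q r s hdet hfix
      have hmem : !![p, q; r, s] ∈ cubicAut b₃ b₂ b₁ b₀ :=
        (mem_cubicAut_iff ..).2 ⟨by rwa [Matrix.det_fin_two_of], hfix⟩
      rw [haut, Set.mem_singleton_iff] at hmem
      have h00 := congrFun₂ hmem 0 0
      have h01 := congrFun₂ hmem 0 1
      have h10 := congrFun₂ hmem 1 0
      have h11 := congrFun₂ hmem 1 1
      simp at h00 h01 h10 h11
      exact ⟨h00, h01, h10, h11⟩
    constructor
    · rintro ⟨m, n, e, f, g, hfac⟩
      obtain ⟨h3, h2, h1, h0⟩ : (b₃ : ℚ) = m * e ∧ (b₂ : ℚ) = m * f + n * e ∧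
          (b₁ : ℚ) = m * g + n * f ∧ (b₀ : ℚ) = n * g :=
        cubic_coeff_ext fun x y => by
          have := hfac x y
          simp only [cubicFormQ] at this
          linear_combination this
      rw [h3, h2, h1, h0] at hΔ' htriv
      obtain ⟨p, q, r, s, hdet, hfix⟩ := exists_fixesCubic_of_linear_factor hΔ'
      obtain ⟨rfl, rfl, rfl, rfl⟩ := htriv p q r s (by rw [hdet]; norm_num) hfix
      norm_num at hdet
    · rintro ⟨t, ht⟩
      obtain ⟨p, q, r, s, hdet, htr, hfix⟩ := exists_fixesCubic_of_disc_eq_sq hΔ' ht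
      obtain ⟨rfl, rfl, rfl, rfl⟩ := htriv p q r s (by rw [hdet]; norm_num) hfix
      norm_num at htr
  · rintro ⟨hirr, hsq⟩
    refine Set.eq_singleton_iff_unique_mem.2 ⟨⟨by simp, fun x y => by simp⟩, fun T hT => ?_⟩
    have hdet := ((mem_cubicAut_iff ..).1 hT).2.det_eq hΔ'
    rw [← Matrix.det_fin_two] at hdet
    rcases hdet with hdet | hdet
    · exact eq_one_of_mem_cubicAut hT hdet hΔ' hsq
    · have hTT : T * T = 1 :=
        eq_one_of_mem_cubicAut (mul_mem_cubicAut hT hT) (by simp [hdet]) hΔ' hsq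
      exact absurd (hasRationalLinearFactor_of_involution hT hdet hTT) hirr
end

section
/- Let F be a binary cubic form with integer coefficients, non-zero discriminant, and non-zero x³-coefficient. Then Aut F = {I, 𝒩_{q_F}, 𝒩_{q_F}², 𝒯_{θ₁}, 𝒯_{θ₂}, 𝒯_{θ₃}} and this group is isomorphic to the dihedral group D₃ of order 6, if and only if F splits completely into linear factors over ℚ (where θ₁, θ₂, θ₃ are the three rational roots of F(x,1)). -/
/-- The principal square root of a complex number: non-negative real part, and positive
imaginary part when the real part vanishes. -/
noncomputable def csqrt (z : ℂ) : ℂ := z ^ ((1 : ℂ) / 2)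

/-- The matrix `M_f = [[b, 2c], [−2a, −b]]` attached to a binary quadratic form
`f = ax² + bxy + cy²`. -/
def Mmat (a b c : ℚ) : Matrix (Fin 2) (Fin 2) ℚ :=
  !![b, 2 * c; -2 * a, -b]

/-- The matrix `𝒯_θ = (−1/(6Δ(F))) · M_{J_θ} · M_{q_F}`, where `J_θ` is the Julia covariant
of `F` at `θ` and `q_F` is the Hessian covariant of `F`. -/
def Tmat (b₃ b₂ b₁ b₀ : ℤ) (θ : ℚ) : Matrix (Fin 2) (Fin 2) ℚ :=
  (-(6 * (cubicDisc b₃ b₂ b₁ b₀ : ℚ))⁻¹) •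
    (Mmat (9 * (b₃ : ℚ) ^ 2 * θ ^ 2 + 6 * (b₃ : ℚ) * (b₂ : ℚ) * θ
          + 6 * (b₃ : ℚ) * (b₁ : ℚ) - (b₂ : ℚ) ^ 2)
        (6 * (b₃ : ℚ) * (b₂ : ℚ) * θ ^ 2 + 6 * ((b₂ : ℚ) ^ 2 - (b₃ : ℚ) * (b₁ : ℚ)) * θ
          + 2 * (b₂ : ℚ) * (b₁ : ℚ))
        (3 * (b₃ : ℚ) * (b₁ : ℚ) * θ ^ 2
          + 3 * ((b₂ : ℚ) * (b₁ : ℚ) - 3 * (b₃ : ℚ) * (b₀ : ℚ)) * θ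
          + 2 * (b₁ : ℚ) ^ 2 - 3 * (b₂ : ℚ) * (b₀ : ℚ)) *
      Mmat ((b₂ : ℚ) ^ 2 - 3 * (b₃ : ℚ) * (b₁ : ℚ))
        ((b₂ : ℚ) * (b₁ : ℚ) - 9 * (b₃ : ℚ) * (b₀ : ℚ))
        ((b₁ : ℚ) ^ 2 - 3 * (b₂ : ℚ) * (b₀ : ℚ)))

/-- The matrix `N_f` attached to the binary quadratic form `f = ax² + bxy + cy²`. -/
noncomputable def Nmat (a b c : ℂ) : Matrix (Fin 2) (Fin 2) ℂ :=
  (2 * (b ^ 2 - 4 * a * c))⁻¹ •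
    !![b * csqrt (-3 * (b ^ 2 - 4 * a * c)) - (b ^ 2 - 4 * a * c),
        2 * c * csqrt (-3 * (b ^ 2 - 4 * a * c));
      -2 * a * csqrt (-3 * (b ^ 2 - 4 * a * c)),
        -(b * csqrt (-3 * (b ^ 2 - 4 * a * c))) - (b ^ 2 - 4 * a * c)]

/-- The matrix `𝒩_{q_F}` attached to the Hessian covariant of the cubic form `F`. -/
noncomputable def NqF (b₃ b₂ b₁ b₀ : ℤ) : Matrix (Fin 2) (Fin 2) ℂ :=
  Nmat ((b₂ ^ 2 - 3 * b₃ * b₁ : ℤ) : ℂ) ((b₂ * b₁ - 9 * b₃ * b₀ : ℤ) : ℂ)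
    ((b₁ ^ 2 - 3 * b₂ * b₀ : ℤ) : ℂ)

/-- The product form of the splitting of a cubic with leading coefficient `b₃` and roots
`a, b, c`. -/
def SplitsWithRoots (b₃ b₂ b₁ b₀ : ℤ) (a b c : ℚ) : Prop :=
  ∀ x y : ℚ, cubicFormQ b₃ b₂ b₁ b₀ x y
    = (b₃ : ℚ) * (x - a * y) * (x - b * y) * (x - c * y)

/-- The matrix of order three inducing the projective rotation `a ↦ c ↦ b ↦ a`. -/
def rootRot (a b c : ℚ) : Matrix (Fin 2) (Fin 2) ℚ :=
  ((a - b) * (a - c) * (b - c))⁻¹ •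
    !![a ^ 2 * c + a * b ^ 2 + b * c ^ 2 - 3 * a * b * c,
        -((a * b + a * c + b * c) ^ 2 - 3 * (a + b + c) * (a * b * c));
      (a + b + c) ^ 2 - 3 * (a * b + a * c + b * c),
        -(a ^ 2 * b + a * c ^ 2 + b ^ 2 * c - 3 * a * b * c)]

/-- The involution negating `(a, 1)` and inducing the projective transposition `b ↔ c`. -/
def rootSwap (a b c : ℚ) : Matrix (Fin 2) (Fin 2) ℚ :=
  (-((a - b) * (a - c))⁻¹) •
    !![a ^ 2 - b * c, 2 * a * b * c - a ^ 2 * b - a ^ 2 * c;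
      2 * a - b - c, b * c - a ^ 2]

/-- `T` sends the line through `(u, 1)` into the line through `(v, 1)`. -/
def MapsLine (T : Matrix (Fin 2) (Fin 2) ℚ) (u v : ℚ) : Prop :=
  T 0 0 * u + T 0 1 = v * (T 1 0 * u + T 1 1)

section SplitForm

variable {b₃ b₂ b₁ b₀ : ℤ} {a b c : ℚ}

theorem SplitsWithRoots.swap_left (h : SplitsWithRoots b₃ b₂ b₁ b₀ a b c) :
    SplitsWithRoots b₃ b₂ b₁ b₀ b a c := fun x y => by rw [h x y]; ring

theorem SplitsWithRoots.swap_right (h : SplitsWithRoots b₃ b₂ b₁ b₀ a b c) :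
    SplitsWithRoots b₃ b₂ b₁ b₀ a c b := fun x y => by rw [h x y]; ring

theorem SplitsWithRoots.coeffs (h : SplitsWithRoots b₃ b₂ b₁ b₀ a b c) :
    (b₂ : ℚ) = -b₃ * (a + b + c) ∧ (b₁ : ℚ) = b₃ * (a * b + a * c + b * c) ∧
      (b₀ : ℚ) = -b₃ * (a * b * c) := by
  have e1 := h 0 1
  have e2 := h 1 1
  have e3 := h 1 (-1)
  simp only [cubicFormQ] at e1 e2 e3
  refine ⟨?_, ?_, ?_⟩
  · linear_combination (e2 - e3) / 2 - e1
  · linear_combination (e2 + e3) / 2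
  · linear_combination e1

theorem SplitsWithRoots.disc (h : SplitsWithRoots b₃ b₂ b₁ b₀ a b c) :
    (cubicDisc b₃ b₂ b₁ b₀ : ℚ) = b₃ ^ 4 * ((a - b) * (a - c) * (b - c)) ^ 2 := by
  obtain ⟨e2, e1, e0⟩ := h.coeffs
  simp only [cubicDisc]
  push_cast
  rw [e2, e1, e0]
  ring

theorem SplitsWithRoots.roots_ne (h : SplitsWithRoots b₃ b₂ b₁ b₀ a b c)
    (hΔ : cubicDisc b₃ b₂ b₁ b₀ ≠ 0) : a ≠ b ∧ a ≠ c ∧ b ≠ c := by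
  have hd : (cubicDisc b₃ b₂ b₁ b₀ : ℚ) ≠ 0 := by exact_mod_cast hΔ
  rw [h.disc] at hd
  refine ⟨?_, ?_, ?_⟩ <;> rintro rfl <;> simp at hd

theorem SplitsWithRoots.hessian_ne (h : SplitsWithRoots b₃ b₂ b₁ b₀ a b c) (hb₃ : b₃ ≠ 0)
    (hab : a ≠ b) : (b₂ : ℚ) ^ 2 - 3 * b₃ * b₁ ≠ 0 := by
  obtain ⟨e2, e1, -⟩ := h.coeffs
  have h3 : (b₃ : ℚ) ≠ 0 := by exact_mod_cast hb₃
  have hpos : 0 < (a - b) ^ 2 := by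
    have := sub_ne_zero.mpr hab
    positivity
  rw [e2, e1]
  have : (-(b₃ : ℚ) * (a + b + c)) ^ 2 - 3 * b₃ * (b₃ * (a * b + a * c + b * c))
      = b₃ ^ 2 * (((a - b) ^ 2 + (a - c) ^ 2 + (b - c) ^ 2) / 2) := by ring
  rw [this]
  have := sq_nonneg (a - c)
  have := sq_nonneg (b - c)
  positivity

theorem SplitsWithRoots.tmat_eq (h : SplitsWithRoots b₃ b₂ b₁ b₀ a b c) (hb₃ : b₃ ≠ 0)
    (hab : a ≠ b) (hac : a ≠ c) (hbc : b ≠ c) :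
    Tmat b₃ b₂ b₁ b₀ a = rootSwap a b c := by
  obtain ⟨e2, e1, e0⟩ := h.coeffs
  have h3 : (b₃ : ℚ) ≠ 0 := by exact_mod_cast hb₃
  have := sub_ne_zero.mpr hab
  have := sub_ne_zero.mpr hac
  have := sub_ne_zero.mpr hbc
  simp only [Tmat, h.disc, rootSwap, Mmat]
  rw [e2, e1, e0]
  ext i j
  fin_cases i <;> fin_cases j <;> simp <;>
    field_simp <;> ring

theorem det_rootRot (hab : a ≠ b) (hac : a ≠ c) (hbc : b ≠ c) : (rootRot a b c).det = 1 := by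
  have := sub_ne_zero.mpr hab
  have := sub_ne_zero.mpr hac
  have := sub_ne_zero.mpr hbc
  simp [rootRot, Matrix.det_fin_two]
  field_simp
  ring

theorem det_rootSwap (hab : a ≠ b) (hac : a ≠ c) : (rootSwap a b c).det = -1 := by
  have := sub_ne_zero.mpr hab
  have := sub_ne_zero.mpr hac
  simp [rootSwap, Matrix.det_fin_two]
  field_simp
  ring

theorem rootSwap_sq (hab : a ≠ b) (hac : a ≠ c) : rootSwap a b c ^ 2 = 1 := by
  have := sub_ne_zero.mpr hab
  have := sub_ne_zero.mpr hac
  ext i j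
  fin_cases i <;> fin_cases j <;>
    simp [rootSwap, pow_two, Matrix.mul_apply, Fin.sum_univ_two] <;> field_simp <;> ring

theorem rootRot_sq (hab : a ≠ b) (hac : a ≠ c) (hbc : b ≠ c) :
    rootRot a b c ^ 2 = rootRot a c b := by
  have := sub_ne_zero.mpr hab
  have := sub_ne_zero.mpr hac
  have := sub_ne_zero.mpr hbc
  have := sub_ne_zero.mpr hbc.symm
  ext i j
  fin_cases i <;> fin_cases j <;>
    simp [rootRot, pow_two, Matrix.mul_apply, Fin.sum_univ_two] <;> field_simp <;> ring

theorem rootRot_mul_rootRot (hab : a ≠ b) (hac : a ≠ c) (hbc : b ≠ c) :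
    rootRot a b c * rootRot a c b = 1 := by
  have := sub_ne_zero.mpr hab
  have := sub_ne_zero.mpr hac
  have := sub_ne_zero.mpr hbc
  have := sub_ne_zero.mpr hbc.symm
  ext i j
  fin_cases i <;> fin_cases j <;>
    simp [rootRot, Matrix.mul_apply, Fin.sum_univ_two] <;> field_simp <;> ring

theorem rootRot_pow_three (hab : a ≠ b) (hac : a ≠ c) (hbc : b ≠ c) :
    rootRot a b c ^ 3 = 1 := by
  rw [pow_succ', rootRot_sq hab hac hbc, rootRot_mul_rootRot hab hac hbc]

theorem rootRot_lower_ne (hab : a ≠ b) (hac : a ≠ c) (hbc : b ≠ c) :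
    rootRot a b c 1 0 ≠ 0 := by
  have h1 := sub_ne_zero.mpr hab
  have h2 := sub_ne_zero.mpr hac
  have h3 := sub_ne_zero.mpr hbc
  have : (a + b + c) ^ 2 - 3 * (a * b + a * c + b * c) ≠ 0 := by
    have : 0 < (a - b) ^ 2 := by positivity
    nlinarith [sq_nonneg (a - c), sq_nonneg (b - c)]
  simp [rootRot, h1, h2, h3, this]

theorem rootRot_lower_swap : rootRot a c b 1 0 = -rootRot a b c 1 0 := by
  have : (a - c) * (a - b) * (c - b) = -((a - b) * (a - c) * (b - c)) := by ring
  simp only [rootRot, this, inv_neg, Matrix.smul_apply, Matrix.of_apply,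
    Matrix.cons_val', Matrix.cons_val_zero, Matrix.cons_val_one, smul_eq_mul]
  ring

theorem SplitsWithRoots.rootRot_mem (h : SplitsWithRoots b₃ b₂ b₁ b₀ a b c)
    (hab : a ≠ b) (hac : a ≠ c) (hbc : b ≠ c) : rootRot a b c ∈ cubicAut b₃ b₂ b₁ b₀ := by
  refine ⟨by simp [det_rootRot hab hac hbc], fun x y => ?_⟩
  have := sub_ne_zero.mpr hab
  have := sub_ne_zero.mpr hac
  have := sub_ne_zero.mpr hbc
  rw [h, h]
  simp [rootRot]
  field_simp
  ring

theorem SplitsWithRoots.rootSwap_mem (h : SplitsWithRoots b₃ b₂ b₁ b₀ a b c)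
    (hab : a ≠ b) (hac : a ≠ c) : rootSwap a b c ∈ cubicAut b₃ b₂ b₁ b₀ := by
  refine ⟨by simp [det_rootSwap hab hac], fun x y => ?_⟩
  have := sub_ne_zero.mpr hab
  have := sub_ne_zero.mpr hac
  rw [h, h]
  simp [rootSwap]
  field_simp
  ring

theorem mapsLine_one (u : ℚ) : MapsLine 1 u u := by simp [MapsLine]

theorem mapsLine_rootSwap (hab : a ≠ b) (hac : a ≠ c) :
    MapsLine (rootSwap a b c) a a ∧ MapsLine (rootSwap a b c) b c ∧
      MapsLine (rootSwap a b c) c b := by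
  have := sub_ne_zero.mpr hab
  have := sub_ne_zero.mpr hac
  refine ⟨?_, ?_, ?_⟩ <;> simp [MapsLine, rootSwap] <;> field_simp <;> ring

theorem mapsLine_rootRot (hab : a ≠ b) (hac : a ≠ c) (hbc : b ≠ c) :
    MapsLine (rootRot a b c) a c ∧ MapsLine (rootRot a b c) b a ∧
      MapsLine (rootRot a b c) c b := by
  have := sub_ne_zero.mpr hab
  have := sub_ne_zero.mpr hac
  have := sub_ne_zero.mpr hbc
  refine ⟨?_, ?_, ?_⟩ <;> simp [MapsLine, rootRot] <;> field_simp <;> ring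

theorem MapsLine.target_ne {T : Matrix (Fin 2) (Fin 2) ℚ} (hT : T.det ≠ 0) {u u' v v' : ℚ}
    (hu : u ≠ u') (h : MapsLine T u v) (h' : MapsLine T u' v') : v ≠ v' := by
  rintro rfl
  apply hT
  simp only [MapsLine] at h h'
  have e : T 0 0 = v * T 1 0 := by
    apply mul_right_cancel₀ (sub_ne_zero.mpr hu)
    linear_combination h - h'
  rw [Matrix.det_fin_two]
  linear_combination (T 1 1 + u * T 1 0) * e - T 1 0 * h

theorem SplitsWithRoots.mapsLine (h : SplitsWithRoots b₃ b₂ b₁ b₀ a b c) (hb₃ : b₃ ≠ 0)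
    {T : Matrix (Fin 2) (Fin 2) ℚ} (hT : T ∈ cubicAut b₃ b₂ b₁ b₀) {u : ℚ}
    (hu : u = a ∨ u = b ∨ u = c) : MapsLine T u a ∨ MapsLine T u b ∨ MapsLine T u c := by
  have h3 : (b₃ : ℚ) ≠ 0 := by exact_mod_cast hb₃
  have e := hT.2 u 1
  rw [h, h] at e
  have z : (b₃ : ℚ) * (u - a * 1) * (u - b * 1) * (u - c * 1) = 0 := by
    rcases hu with rfl | rfl | rfl <;> simp
  rw [z] at e
  simpa [MapsLine, h3, sub_eq_zero, or_assoc] using e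

theorem eq_of_mapsLine (h3 : b₃ ≠ 0) (hab : a ≠ b) (hac : a ≠ c) (hbc : b ≠ c)
    {T S : Matrix (Fin 2) (Fin 2) ℚ} (hT : T ∈ cubicAut b₃ b₂ b₁ b₀)
    (hS : S ∈ cubicAut b₃ b₂ b₁ b₀) {a' b' c' : ℚ} (ha : MapsLine T a a') (hb : MapsLine T b b')
    (hc : MapsLine T c c') (ha' : MapsLine S a a') (hb' : MapsLine S b b')
    (hc' : MapsLine S c c') : T = S := by
  have hd := hS.1
  have hb3 : (b₃ : ℚ) ≠ 0 := by exact_mod_cast h3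
  -- the adjugate of `S` times `T` fixes three lines, hence is scalar
  have key : ∀ u v, MapsLine T u v → MapsLine S u v →
      (S 0 0 * T 1 0 - S 1 0 * T 0 0) * u ^ 2 + ((S 0 0 * T 1 1 - S 1 0 * T 0 1)
        - (S 1 1 * T 0 0 - S 0 1 * T 1 0)) * u - (S 1 1 * T 0 1 - S 0 1 * T 1 1) = 0 := by
    intro u v h h'
    simp only [MapsLine] at h h'
    linear_combination (T 1 0 * u + T 1 1) * h' - (S 1 0 * u + S 1 1) * h
  have ka := key _ _ ha ha'
  have kb := key _ _ hb hb'
  have kc := key _ _ hc hc'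
  set P := S 0 0 * T 1 0 - S 1 0 * T 0 0 with hP
  set Q := (S 0 0 * T 1 1 - S 1 0 * T 0 1) - (S 1 1 * T 0 0 - S 0 1 * T 1 0) with hQ
  set R := S 1 1 * T 0 1 - S 0 1 * T 1 1 with hR
  have s1 : P * (a + b) + Q = 0 := by
    apply mul_right_cancel₀ (sub_ne_zero.mpr hab)
    linear_combination ka - kb
  have s2 : P * (a + c) + Q = 0 := by
    apply mul_right_cancel₀ (sub_ne_zero.mpr hac)
    linear_combination ka - kc
  have P0 : P = 0 := by
    apply mul_right_cancel₀ (sub_ne_zero.mpr hbc)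
    linear_combination s1 - s2
  have Q0 : Q = 0 := by linear_combination s1 - (a + b) * P0
  have R0 : R = 0 := by linear_combination -ka + a ^ 2 * P0 + a * Q0
  rw [hP] at P0
  rw [hQ] at Q0
  rw [hR] at R0
  rw [Matrix.det_fin_two] at hd
  obtain ⟨m, hm⟩ : ∃ m, m * (S 0 0 * S 1 1 - S 0 1 * S 1 0)
      = S 1 1 * T 0 0 - S 0 1 * T 1 0 := ⟨_, div_mul_cancel₀ _ hd⟩
  have t00 : T 0 0 = m * S 0 0 := by
    apply mul_right_cancel₀ hd
    linear_combination S 0 1 * P0 - S 0 0 * hm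
  have t10 : T 1 0 = m * S 1 0 := by
    apply mul_right_cancel₀ hd
    linear_combination S 1 1 * P0 - S 1 0 * hm
  have t01 : T 0 1 = m * S 0 1 := by
    apply mul_right_cancel₀ hd
    linear_combination S 0 1 * Q0 + S 0 0 * R0 - S 0 1 * hm
  have t11 : T 1 1 = m * S 1 1 := by
    apply mul_right_cancel₀ hd
    linear_combination S 1 1 * Q0 + S 1 0 * R0 - S 1 1 * hm
  -- evaluating the form at a preimage of `(1, 0)` shows that the scalar is a cube root of `1`
  have e1 := hT.2 (S 1 1) (-S 1 0)
  have e2 := hS.2 (S 1 1) (-S 1 0)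
  rw [← e2, t00, t01, t10, t11] at e1
  simp only [cubicFormQ] at e1
  have hm3 : m ^ 3 = 1 := by
    have hd3 := pow_ne_zero 3 hd
    apply mul_right_cancel₀ (mul_ne_zero hb3 hd3)
    linear_combination e1
  have hm1 : m = 1 := by
    have : m ^ 3 = 1 ^ 3 := by rw [hm3, one_pow]
    exact (Odd.strictMono_pow (by decide : Odd 3)).injective this
  subst hm1
  ext i j
  fin_cases i <;> fin_cases j <;> simp [*]

theorem one_mem_cubicAut : (1 : Matrix (Fin 2) (Fin 2) ℚ) ∈ cubicAut b₃ b₂ b₁ b₀ := by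
  simp [cubicAut]

theorem SplitsWithRoots.cubicAut_eq (h : SplitsWithRoots b₃ b₂ b₁ b₀ a b c) (hb₃ : b₃ ≠ 0)
    (hab : a ≠ b) (hac : a ≠ c) (hbc : b ≠ c) :
    cubicAut b₃ b₂ b₁ b₀ = {1, rootRot a b c, rootRot a c b, rootSwap a b c, rootSwap b a c,
      rootSwap c a b} := by
  have m2 := h.rootRot_mem hab hac hbc
  have m3 := h.swap_right.rootRot_mem hac hab hbc.symm
  have m4 := h.rootSwap_mem hab hac
  have m5 := h.swap_left.rootSwap_mem hab.symm hbc
  have m6 := h.swap_right.swap_left.rootSwap_mem hac.symm hbc.symm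
  obtain ⟨r1, r2, r3⟩ := mapsLine_rootRot hab hac hbc
  obtain ⟨s1, s2, s3⟩ := mapsLine_rootRot hac hab hbc.symm
  obtain ⟨t1, t2, t3⟩ := mapsLine_rootSwap hab hac
  obtain ⟨u1, u2, u3⟩ := mapsLine_rootSwap hab.symm hbc
  obtain ⟨v1, v2, v3⟩ := mapsLine_rootSwap hac.symm hbc.symm
  apply Set.Subset.antisymm
  · intro T hT
    simp only [Set.mem_insert_iff, Set.mem_singleton_iff]
    have eq_of := fun {S a' b' c'} => eq_of_mapsLine (S := S) (a' := a') (b' := b') (c' := c')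
      hb₃ hab hac hbc hT
    rcases h.mapsLine hb₃ hT (u := a) (by simp) with ha | ha | ha <;>
    rcases h.mapsLine hb₃ hT (u := b) (by simp) with hb | hb | hb <;>
    try exact absurd rfl (ha.target_ne hT.1 hab hb)
    all_goals
      rcases h.mapsLine hb₃ hT (u := c) (by simp) with hc | hc | hc <;>
      first
      | exact absurd rfl (ha.target_ne hT.1 hac hc)
      | exact absurd rfl (hb.target_ne hT.1 hbc hc)
      | skip
    · exact .inl (eq_of one_mem_cubicAut ha hb hc (mapsLine_one a) (mapsLine_one b)
        (mapsLine_one c))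
    · exact .inr <| .inr <| .inr <| .inl (eq_of m4 ha hb hc t1 t2 t3)
    · exact .inr <| .inr <| .inr <| .inr <| .inr (eq_of m6 ha hb hc v2 v3 v1)
    · exact .inr <| .inr <| .inl (eq_of m3 ha hb hc s1 s3 s2)
    · exact .inr <| .inl (eq_of m2 ha hb hc r1 r2 r3)
    · exact .inr <| .inr <| .inr <| .inr <| .inl (eq_of m5 ha hb hc u2 u1 u3)
  · rintro T (rfl | rfl | rfl | rfl | rfl | rfl)
    exacts [one_mem_cubicAut, m2, m3, m4, m5, m6]

end SplitForm

theorem tmat_injective {b₃ b₂ b₁ b₀ : ℤ} (hb₃ : b₃ ≠ 0) (hΔ : cubicDisc b₃ b₂ b₁ b₀ ≠ 0)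
    (hA : (b₂ : ℚ) ^ 2 - 3 * b₃ * b₁ ≠ 0) {s t : ℚ}
    (h : Tmat b₃ b₂ b₁ b₀ s = Tmat b₃ b₂ b₁ b₀ t) : s = t := by
  have h3 : (b₃ : ℚ) ≠ 0 := by exact_mod_cast hb₃
  have hd : (cubicDisc b₃ b₂ b₁ b₀ : ℚ) ≠ 0 := by exact_mod_cast hΔ
  have hk : (-(6 * (cubicDisc b₃ b₂ b₁ b₀ : ℚ))⁻¹) ≠ 0 := by simp [hd]
  have h' := smul_right_injective _ hk h
  have e10 := congrFun (congrFun h' 1) 0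
  have e11 := congrFun (congrFun h' 1) 1
  simp [Matrix.mul_apply, Fin.sum_univ_two, Mmat] at e10 e11
  have hd' : (18 * b₃ * b₂ * b₁ * b₀ - 4 * b₂ ^ 3 * b₀ + b₂ ^ 2 * b₁ ^ 2
    - 4 * b₃ * b₁ ^ 3 - 27 * b₃ ^ 2 * b₀ ^ 2 : ℚ) ≠ 0 := by
    simpa [cubicDisc] using hd
  set A := (b₂ : ℚ) ^ 2 - 3 * b₃ * b₁ with hA'
  set B := (b₂ : ℚ) * b₁ - 9 * b₃ * b₀ with hB'
  set C := (b₁ : ℚ) ^ 2 - 3 * b₂ * b₀ with hC'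
  have hq : B ^ 2 - 4 * A * C ≠ 0 := by
    have : B ^ 2 - 4 * A * C = -3 * (18 * b₃ * b₂ * b₁ * b₀ - 4 * b₂ ^ 3 * b₀ + b₂ ^ 2 * b₁ ^ 2
      - 4 * b₃ * b₁ ^ 3 - 27 * b₃ ^ 2 * b₀ ^ 2 : ℚ) := by rw [hA', hB', hC']; ring
    rw [this]
    exact mul_ne_zero (by norm_num) hd'
  have d2 : (9 * (b₃ : ℚ) ^ 2 * s ^ 2 + 6 * b₃ * b₂ * s)
      - (9 * (b₃ : ℚ) ^ 2 * t ^ 2 + 6 * b₃ * b₂ * t) = 0 := by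
    apply mul_right_cancel₀ hq
    linear_combination -B / 2 * e10 + A * e11
  have d1 : (6 * (b₃ : ℚ) * b₂ * s ^ 2 + 6 * ((b₂ : ℚ) ^ 2 - b₃ * b₁) * s)
      - (6 * (b₃ : ℚ) * b₂ * t ^ 2 + 6 * ((b₂ : ℚ) ^ 2 - b₃ * b₁) * t) = 0 := by
    apply mul_right_cancel₀ hA
    linear_combination e10 / 2 + B * d2
  by_contra hne
  have hst := sub_ne_zero.mpr hne
  have f2 : 3 * b₃ * (s + t) + 2 * b₂ = 0 := by
    apply mul_right_cancel₀ (mul_ne_zero hst (mul_ne_zero three_ne_zero h3))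
    linear_combination d2
  have f1 : b₃ * b₂ * (s + t) + b₂ ^ 2 - b₃ * b₁ = 0 := by
    apply mul_right_cancel₀ (mul_ne_zero hst (by norm_num : (6 : ℚ) ≠ 0))
    linear_combination d1
  apply hA
  rw [hA']
  linear_combination 3 * f1 - b₂ * f2

theorem csqrt_sq (z : ℂ) : csqrt z ^ 2 = z := by
  rw [csqrt, one_div]
  exact_mod_cast Complex.cpow_nat_inv_pow z two_ne_zero

theorem csqrt_ofReal_sq {r : ℝ} (hr : 0 ≤ r) : csqrt ((r : ℂ) ^ 2) = r := by
  have h := Complex.ofReal_cpow (sq_nonneg r) (1 / 2)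
  rw [← Real.sqrt_eq_rpow, Real.sqrt_sq hr] at h
  push_cast at h
  exact h.symm

theorem SplitsWithRoots.nqF_eq {b₃ b₂ b₁ b₀ : ℤ} {a b c : ℚ}
    (h : SplitsWithRoots b₃ b₂ b₁ b₀ a b c) (hb₃ : b₃ ≠ 0)
    (hab : a ≠ b) (hac : a ≠ c) (hbc : b ≠ c) (hd : 0 ≤ (a - b) * (a - c) * (b - c)) :
    (rootRot a b c).map (fun q : ℚ => (q : ℂ)) = NqF b₃ b₂ b₁ b₀ := by
  obtain ⟨e2, e1, e0⟩ := h.coeffs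
  have f2 : (b₂ : ℂ) = -b₃ * (a + b + c) := by exact_mod_cast congrArg (Rat.cast : ℚ → ℂ) e2
  have f1 : (b₁ : ℂ) = b₃ * (a * b + a * c + b * c) := by
    exact_mod_cast congrArg (Rat.cast : ℚ → ℂ) e1
  have f0 : (b₀ : ℂ) = -b₃ * (a * b * c) := by exact_mod_cast congrArg (Rat.cast : ℚ → ℂ) e0
  have h3 : (b₃ : ℂ) ≠ 0 := by exact_mod_cast hb₃
  have g1 : (a : ℂ) - b ≠ 0 := by exact_mod_cast sub_ne_zero.mpr hab
  have g2 : (a : ℂ) - c ≠ 0 := by exact_mod_cast sub_ne_zero.mpr hac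
  have g3 : (b : ℂ) - c ≠ 0 := by exact_mod_cast sub_ne_zero.mpr hbc
  have hq : ((b₂ * b₁ - 9 * b₃ * b₀ : ℤ) : ℂ) ^ 2 - 4 * ((b₂ ^ 2 - 3 * b₃ * b₁ : ℤ) : ℂ)
      * ((b₁ ^ 2 - 3 * b₂ * b₀ : ℤ) : ℂ)
      = -3 * (b₃ ^ 2 * ((a - b) * (a - c) * (b - c))) ^ 2 := by
    push_cast
    rw [f2, f1, f0]
    ring
  have hs : csqrt (-3 * (-3 * ((b₃ : ℂ) ^ 2 * ((a - b) * (a - c) * (b - c))) ^ 2))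
      = 3 * (b₃ ^ 2 * ((a - b) * (a - c) * (b - c))) := by
    have hr : (0 : ℝ) ≤ ((3 * ((b₃ : ℚ) ^ 2 * ((a - b) * (a - c) * (b - c))) : ℚ) : ℝ) := by
      have : 0 ≤ 3 * ((b₃ : ℚ) ^ 2 * ((a - b) * (a - c) * (b - c))) := by positivity
      exact_mod_cast this
    have := csqrt_ofReal_sq hr
    push_cast at this
    rw [← this]
    congr 1
    ring
  rw [NqF, Nmat, hq, hs]
  push_cast
  rw [f2, f1, f0]
  ext i j
  fin_cases i <;> fin_cases j <;> simp [rootRot] <;> field_simp <;> ring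

/-- Rationality of `𝒩_{q_F}` forces a nonzero leading coefficient of the Hessian. -/
theorem hessian_leading_ne_zero {b₃ b₂ b₁ b₀ : ℤ} (hΔ : cubicDisc b₃ b₂ b₁ b₀ ≠ 0)
    {N : Matrix (Fin 2) (Fin 2) ℚ} (hN : N.map (fun q : ℚ => (q : ℂ)) = NqF b₃ b₂ b₁ b₀) :
    b₂ ^ 2 - 3 * b₃ * b₁ ≠ 0 := by
  intro hA
  have hq : (b₂ * b₁ - 9 * b₃ * b₀) ^ 2 - 4 * (b₂ ^ 2 - 3 * b₃ * b₁) * (b₁ ^ 2 - 3 * b₂ * b₀)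
      = -3 * cubicDisc b₃ b₂ b₁ b₀ := by rw [cubicDisc]; ring
  rw [hA] at hq
  have hB : b₂ * b₁ - 9 * b₃ * b₀ ≠ 0 := by
    intro h0
    rw [h0] at hq
    apply hΔ
    linarith
  have e := congrFun (congrFun hN 0) 0
  rw [NqF, hA] at e
  generalize b₂ * b₁ - 9 * b₃ * b₀ = B at e hB
  have hBc : (B : ℂ) ≠ 0 := by exact_mod_cast hB
  simp [Nmat] at e
  have hs := csqrt_sq (-(3 * (B : ℂ) ^ 2))
  generalize csqrt (-(3 * (B : ℂ) ^ 2)) = s at e hs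
  have es : s = ((B * (2 * N 0 0 + 1) : ℚ) : ℂ) := by
    push_cast
    rw [e]
    field_simp
    ring
  rw [es] at hs
  have hs' : (B * (2 * N 0 0 + 1) : ℚ) ^ 2 = -(3 * (B : ℚ) ^ 2) := by exact_mod_cast hs
  have : (0 : ℚ) < (B : ℚ) ^ 2 := by
    have : (B : ℚ) ≠ 0 := by exact_mod_cast hB
    positivity
  nlinarith [sq_nonneg (B * (2 * N 0 0 + 1) : ℚ)]

theorem root_or_linear_of_tmat_sq {b₃ b₂ b₁ b₀ : ℤ} (hΔ : cubicDisc b₃ b₂ b₁ b₀ ≠ 0) {t : ℚ}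
    (h : Tmat b₃ b₂ b₁ b₀ t ^ 2 = 1) :
    cubicFormQ b₃ b₂ b₁ b₀ t 1 = 0 ∨
      b₃ * (b₂ ^ 2 - 3 * b₃ * b₁) * t + (b₂ ^ 3 - 4 * b₃ * b₂ * b₁ + 9 * b₃ ^ 2 * b₀) = 0 := by
  have hd : (cubicDisc b₃ b₂ b₁ b₀ : ℚ) ≠ 0 := by exact_mod_cast hΔ
  have e := congrFun (congrFun h 0) 0
  simp [pow_two, Tmat, Mmat, Matrix.mul_apply, Fin.sum_univ_two] at e
  rw [← mul_eq_zero]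
  field_simp at e
  simp only [cubicDisc] at e hd
  push_cast at e hd
  apply mul_left_cancel₀ hd
  simp only [cubicFormQ]
  linear_combination e / 108

theorem exists_splitsWithRoots {b₃ b₂ b₁ b₀ : ℤ} (hb₃ : b₃ ≠ 0) {s t : ℚ} (hst : s ≠ t)
    (hs : cubicFormQ b₃ b₂ b₁ b₀ s 1 = 0) (ht : cubicFormQ b₃ b₂ b₁ b₀ t 1 = 0) :
    ∃ r, SplitsWithRoots b₃ b₂ b₁ b₀ s t r := by
  have h3 : (b₃ : ℚ) ≠ 0 := by exact_mod_cast hb₃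
  obtain ⟨r, hr⟩ : ∃ r : ℚ, (b₂ : ℚ) = -b₃ * (s + t + r) :=
    ⟨-b₂ / b₃ - s - t, by field_simp; ring⟩
  simp only [cubicFormQ] at hs ht
  have h1 : (b₁ : ℚ) = b₃ * (s * t + s * r + t * r) := by
    apply mul_right_cancel₀ (sub_ne_zero.mpr hst)
    linear_combination hs - ht - (s ^ 2 - t ^ 2) * hr
  have h0 : (b₀ : ℚ) = -b₃ * (s * t * r) := by
    linear_combination hs - s ^ 2 * hr - s * h1
  refine ⟨r, fun x y => ?_⟩
  rw [cubicFormQ, hr, h1, h0]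
  ring

theorem splitsWithRoots_of_two_roots {b₃ b₂ b₁ b₀ : ℤ} (hb₃ : b₃ ≠ 0)
    (hΔ : cubicDisc b₃ b₂ b₁ b₀ ≠ 0) (hA : (b₂ : ℚ) ^ 2 - 3 * b₃ * b₁ ≠ 0) {s t u : ℚ}
    (hst : s ≠ t)
    (hmem : ∀ T ∈ cubicAut b₃ b₂ b₁ b₀, T.det = -1 → T = Tmat b₃ b₂ b₁ b₀ s ∨
      T = Tmat b₃ b₂ b₁ b₀ t ∨ T = Tmat b₃ b₂ b₁ b₀ u)
    (hs : cubicFormQ b₃ b₂ b₁ b₀ s 1 = 0) (ht : cubicFormQ b₃ b₂ b₁ b₀ t 1 = 0) :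
    SplitsWithRoots b₃ b₂ b₁ b₀ s t u := by
  obtain ⟨r, hr⟩ := exists_splitsWithRoots hb₃ hst hs ht
  obtain ⟨-, hsr, htr⟩ := hr.roots_ne hΔ
  have hr' := hr.swap_right.swap_left
  have hm := hmem _ (hr'.rootSwap_mem hsr.symm htr.symm) (det_rootSwap hsr.symm htr.symm)
  rw [← hr'.tmat_eq hb₃ hsr.symm htr.symm hst] at hm
  rcases hm with e | e | e
  · exact absurd (tmat_injective hb₃ hΔ hA e).symm hsr
  · exact absurd (tmat_injective hb₃ hΔ hA e).symm htr
  · rwa [← tmat_injective hb₃ hΔ hA e]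

theorem SplitsWithRoots.aut_structure {b₃ b₂ b₁ b₀ : ℤ} {a b c : ℚ}
    (h : SplitsWithRoots b₃ b₂ b₁ b₀ a b c) (hb₃ : b₃ ≠ 0) (hΔ : cubicDisc b₃ b₂ b₁ b₀ ≠ 0)
    {N : Matrix (Fin 2) (Fin 2) ℚ} (hN : N = rootRot a b c ∨ N = rootRot a c b) :
    cubicAut b₃ b₂ b₁ b₀ =
        {1, N, N ^ 2, Tmat b₃ b₂ b₁ b₀ a, Tmat b₃ b₂ b₁ b₀ b, Tmat b₃ b₂ b₁ b₀ c} ∧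
      ({1, N, N ^ 2, Tmat b₃ b₂ b₁ b₀ a, Tmat b₃ b₂ b₁ b₀ b, Tmat b₃ b₂ b₁ b₀ c}
        : Set (Matrix (Fin 2) (Fin 2) ℚ)).ncard = 6 ∧
      N ^ 3 = 1 ∧ Tmat b₃ b₂ b₁ b₀ a ^ 2 = 1 ∧ Tmat b₃ b₂ b₁ b₀ b ^ 2 = 1 ∧
      Tmat b₃ b₂ b₁ b₀ c ^ 2 = 1 := by
  obtain ⟨hab, hac, hbc⟩ := h.roots_ne hΔ
  have inj := fun {s t} => tmat_injective (s := s) (t := t) hb₃ hΔ (h.hessian_ne hb₃ hab)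
  have nab := mt inj hab
  have nac := mt inj hac
  have nbc := mt inj hbc
  rw [h.tmat_eq hb₃ hab hac hbc, h.swap_left.tmat_eq hb₃ hab.symm hbc hac,
    h.swap_right.swap_left.tmat_eq hb₃ hac.symm hbc.symm hab] at *
  have da := det_rootSwap hab hac
  have db := det_rootSwap hab.symm hbc
  have dc := det_rootSwap hac.symm hbc.symm
  have hAut := h.cubicAut_eq hb₃ hab hac hbc
  have hlow : N 1 0 ≠ 0 ∧ (N ^ 2) 1 0 = -N 1 0 := by
    rcases hN with rfl | rfl
    · exact ⟨rootRot_lower_ne hab hac hbc, by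
        rw [rootRot_sq hab hac hbc, rootRot_lower_swap]⟩
    · exact ⟨rootRot_lower_ne hac hab hbc.symm, by
        rw [rootRot_sq hac hab hbc.symm, rootRot_lower_swap]⟩
  have hdet : N.det = 1 := by
    rcases hN with rfl | rfl
    · exact det_rootRot hab hac hbc
    · exact det_rootRot hac hab hbc.symm
  have ne_swap : ∀ {X Y : Matrix (Fin 2) (Fin 2) ℚ}, X.det = 1 → Y.det = -1 → X ≠ Y := by
    rintro X Y hX hY rfl
    norm_num [hX] at hY
  have d1 : (1 : Matrix (Fin 2) (Fin 2) ℚ).det = 1 := Matrix.det_one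
  have d2 : (N ^ 2).det = 1 := by rw [Matrix.det_pow, hdet, one_pow]
  have n1 : 1 ≠ N := by
    rintro rfl
    simp at hlow
  have n2 : 1 ≠ N ^ 2 := by
    intro e
    have := hlow.2
    rw [← e] at this
    simp at this
    exact hlow.1 this
  have n3 : N ≠ N ^ 2 := by
    intro e
    have := hlow.2
    rw [← e] at this
    exact hlow.1 (by linarith)
  refine ⟨?_, ?_, ?_, rootSwap_sq hab hac, rootSwap_sq hab.symm hbc,
    rootSwap_sq hac.symm hbc.symm⟩
  · rw [hAut]
    rcases hN with rfl | rfl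
    · rw [rootRot_sq hab hac hbc]
    · rw [rootRot_sq hac hab hbc.symm, Set.insert_comm (rootRot a c b) (rootRot a b c)]
  · rw [Set.ncard_insert_of_notMem, Set.ncard_insert_of_notMem, Set.ncard_insert_of_notMem,
      Set.ncard_insert_of_notMem, Set.ncard_pair nbc]
    · simp [nab, nac]
    · simp [ne_swap d2 da, ne_swap d2 db, ne_swap d2 dc]
    · simp [n3, ne_swap hdet da, ne_swap hdet db, ne_swap hdet dc]
    · simp [n1, n2, ne_swap d1 da, ne_swap d1 db, ne_swap d1 dc]
  · rcases hN with rfl | rfl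
    · exact rootRot_pow_three hab hac hbc
    · exact rootRot_pow_three hac hab hbc.symm

/-- For a binary cubic form with integer coefficients, non-zero discriminant and non-zero
`x³`-coefficient, and pairwise distinct rationals `θ₁, θ₂, θ₃`: `F` splits completely over
`ℚ` with roots `θ₁, θ₂, θ₃` iff
`Aut F = {I, 𝒩_{q_F}, 𝒩_{q_F}², 𝒯_{θ₁}, 𝒯_{θ₂}, 𝒯_{θ₃}}` is a (dihedral) group of order 6
in which `𝒩_{q_F}` has order dividing 3 and each `𝒯_{θᵢ}` squares to the identity. -/
theorem cubic_aut_dihedral_iff (b₃ b₂ b₁ b₀ : ℤ) (hb₃ : b₃ ≠ 0)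
    (hΔ : cubicDisc b₃ b₂ b₁ b₀ ≠ 0) (θ₁ θ₂ θ₃ : ℚ)
    (h12 : θ₁ ≠ θ₂) (h13 : θ₁ ≠ θ₃) (h23 : θ₂ ≠ θ₃) :
    (∀ x y : ℚ, cubicFormQ b₃ b₂ b₁ b₀ x y
        = (b₃ : ℚ) * (x - θ₁ * y) * (x - θ₂ * y) * (x - θ₃ * y)) ↔
      (∃ N : Matrix (Fin 2) (Fin 2) ℚ,
        N.map (fun q : ℚ => (q : ℂ)) = NqF b₃ b₂ b₁ b₀ ∧
        cubicAut b₃ b₂ b₁ b₀ =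
          {1, N, N ^ 2, Tmat b₃ b₂ b₁ b₀ θ₁, Tmat b₃ b₂ b₁ b₀ θ₂, Tmat b₃ b₂ b₁ b₀ θ₃} ∧
        ({1, N, N ^ 2, Tmat b₃ b₂ b₁ b₀ θ₁, Tmat b₃ b₂ b₁ b₀ θ₂, Tmat b₃ b₂ b₁ b₀ θ₃}
          : Set (Matrix (Fin 2) (Fin 2) ℚ)).ncard = 6 ∧
        N ^ 3 = 1 ∧
        Tmat b₃ b₂ b₁ b₀ θ₁ ^ 2 = 1 ∧ Tmat b₃ b₂ b₁ b₀ θ₂ ^ 2 = 1 ∧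
        Tmat b₃ b₂ b₁ b₀ θ₃ ^ 2 = 1) := by
  constructor
  · intro h
    have hs : SplitsWithRoots b₃ b₂ b₁ b₀ θ₁ θ₂ θ₃ := h
    rcases le_total 0 ((θ₁ - θ₂) * (θ₁ - θ₃) * (θ₂ - θ₃)) with hd | hd
    · exact ⟨_, hs.nqF_eq hb₃ h12 h13 h23 hd, hs.aut_structure hb₃ hΔ (.inl rfl)⟩
    · exact ⟨_, hs.swap_right.nqF_eq hb₃ h13 h12 h23.symm (by linarith),
        hs.aut_structure hb₃ hΔ (.inr rfl)⟩
  · rintro ⟨N, hN, hAut, -, hN3, hT1, hT2, hT3⟩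
    have hA : (b₂ : ℚ) ^ 2 - 3 * b₃ * b₁ ≠ 0 := by
      exact_mod_cast hessian_leading_ne_zero hΔ hN
    have h3 : (b₃ : ℚ) ≠ 0 := by exact_mod_cast hb₃
    have hdet : N.det = 1 := by
      have e : N.det ^ 3 = 1 ^ 3 := by rw [← Matrix.det_pow, hN3, Matrix.det_one, one_pow]
      exact (Odd.strictMono_pow (by decide : Odd 3)).injective e
    have hmem : ∀ T ∈ cubicAut b₃ b₂ b₁ b₀, T.det = -1 → T = Tmat b₃ b₂ b₁ b₀ θ₁ ∨
        T = Tmat b₃ b₂ b₁ b₀ θ₂ ∨ T = Tmat b₃ b₂ b₁ b₀ θ₃ := by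
      intro T hT hTd
      rw [hAut] at hT
      rcases hT with rfl | rfl | rfl | hT
      · norm_num at hTd
      · norm_num [hdet] at hTd
      · norm_num [hdet] at hTd
      · exact hT
    have hlin : ∀ {s t : ℚ}, s ≠ t →
        b₃ * (b₂ ^ 2 - 3 * b₃ * b₁) * s + (b₂ ^ 3 - 4 * b₃ * b₂ * b₁ + 9 * b₃ ^ 2 * b₀) = 0 →
        b₃ * (b₂ ^ 2 - 3 * b₃ * b₁) * t + (b₂ ^ 3 - 4 * b₃ * b₂ * b₁ + 9 * b₃ ^ 2 * b₀) = 0 →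
        False := by
      intro s t hst e e'
      refine mul_ne_zero (mul_ne_zero h3 hA) (sub_ne_zero.mpr hst) ?_
      linear_combination e - e'
    rcases root_or_linear_of_tmat_sq hΔ hT1 with r1 | l1
    · rcases root_or_linear_of_tmat_sq hΔ hT2 with r2 | l2
      · exact splitsWithRoots_of_two_roots hb₃ hΔ hA h12 hmem r1 r2
      · rcases root_or_linear_of_tmat_sq hΔ hT3 with r3 | l3
        · exact (splitsWithRoots_of_two_roots hb₃ hΔ hA h13
            (fun T hT hd => by have := hmem T hT hd; tauto) r1 r3).swap_right
        · exact (hlin h23 l2 l3).elim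
    · rcases root_or_linear_of_tmat_sq hΔ hT2 with r2 | l2
      · rcases root_or_linear_of_tmat_sq hΔ hT3 with r3 | l3
        · exact (splitsWithRoots_of_two_roots hb₃ hΔ hA h23
            (fun T hT hd => by have := hmem T hT hd; tauto) r2 r3).swap_right.swap_left
        · exact (hlin h13 l1 l3).elim
      · exact (hlin h12 l1 l2).elim
end
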